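/- arXiv:2203.00646 — 2 statements merged into one kernel-verified Lean document; each statement's English description precedes it below -/
import Mathlib

section
/- Let $p$ be a prime, let $n\ge 4$, let $1\le k<\ell\le n-2$, and let $\alpha$ be the composition of length $n-1$ with the value $2$ in positions $1$, $k+1$ and $\ell+1$, and all other parts $1$. Then $g_\alpha(p) = p^{3n-k-\ell-9} + (n-\ell-1)(p-1)(p+1)p^{2n-k-7} + (n-k-1)(p-1)p^{2n-\ell-6} - (n-\ell-1)p^{n-4}(p-1) + (n-k-2)(n-\ell-1)(p-1)^2p^{n-4} + \left((n-\ell-2)+\binom{n-\ell-2}{2}\right)(p-1)(p-2)(p-3)p^{n-4}$. -/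
/-- `A` is an irreducible subring matrix for the prime `p` with diagonal given by the
composition `α = (e₁, …, e_m)` (so `A` is `(m+1) × (m+1)`): `A` is upper triangular with
diagonal `(p^{e₁}, …, p^{e_m}, 1)`, last column `(1, …, 1)ᵀ`, the above-diagonal entries
among the first `m` columns are divisible by `p` and lie in `[0, p^{eᵢ})`, and the
componentwise product of any two columns lies in the `ℤ`-span of the columns. -/
def IsIrrSubringMatrix (p : ℕ) {m : ℕ} (α : Fin m → ℕ)
    (A : Matrix (Fin (m + 1)) (Fin (m + 1)) ℤ) : Prop :=
  (∀ i j : Fin (m + 1), (j : ℕ) < (i : ℕ) → A i j = 0) ∧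
  (∀ i : Fin m, A i.castSucc i.castSucc = (p : ℤ) ^ α i) ∧
  (∀ i : Fin (m + 1), A i (Fin.last m) = 1) ∧
  (∀ i j : Fin m, (i : ℕ) < (j : ℕ) →
    (p : ℤ) ∣ A i.castSucc j.castSucc ∧ 0 ≤ A i.castSucc j.castSucc ∧
      A i.castSucc j.castSucc < (p : ℤ) ^ α i) ∧
  (∀ i j : Fin (m + 1), ∃ x : Fin (m + 1) → ℤ, A.mulVec x = fun r => A r i * A r j)

/-- `gMat p α` is the number of irreducible subring matrices with diagonal `α`. -/
noncomputable def gMat (p : ℕ) {m : ℕ} (α : Fin m → ℕ) : ℕ :=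
  Nat.card {A : Matrix (Fin (m + 1)) (Fin (m + 1)) ℤ // IsIrrSubringMatrix p α A}

namespace IrrSubring

section Matrix

variable {m : ℕ} {p : ℤ} {o k l : Fin m} {X Y Z : Fin m → ℤ}

/-- Rows `o`, `k`, `l` are `X`, `Y`, `Z`; all other rows vanish. -/
def rowCoeff (o k l : Fin m) (X Y Z : Fin m → ℤ) (r c : Fin m) : ℤ :=
  if r = o then X c else if r = k then Y c else if r = l then Z c else 0

/-- The composition with value `2` at `o`, `k`, `l` and value `1` elsewhere. -/
def diagExp (o k l r : Fin m) : ℕ := if r = o ∨ r = k ∨ r = l then 2 else 1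

/-- The matrix with diagonal `(p ^ diagExp, 1)`, last column `1`, and `p * rowCoeff` as the
remaining entries. -/
def blockMat (p : ℤ) (o k l : Fin m) (X Y Z : Fin m → ℤ) :
    Matrix (Fin (m + 1)) (Fin (m + 1)) ℤ := fun r c =>
  Fin.lastCases (motive := fun _ => ℤ)
    (Fin.lastCases (motive := fun _ => ℤ) 1 (fun _ => 0) c)
    (fun r' => Fin.lastCases (motive := fun _ => ℤ) 1
      (fun c' => (if r' = c' then p ^ diagExp o k l r' else 0)
        + p * rowCoeff o k l X Y Z r' c') c) r

lemma blockMat_castSucc_castSucc (r c : Fin m) :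
    blockMat p o k l X Y Z r.castSucc c.castSucc =
      (if r = c then p ^ diagExp o k l r else 0) + p * rowCoeff o k l X Y Z r c := by
  simp [blockMat]

lemma blockMat_last_castSucc (c : Fin m) :
    blockMat p o k l X Y Z (Fin.last m) c.castSucc = 0 := by
  simp [blockMat]

lemma blockMat_last (r : Fin (m + 1)) : blockMat p o k l X Y Z r (Fin.last m) = 1 := by
  cases r using Fin.lastCases <;> simp [blockMat]

lemma blockMat_mulVec_castSucc (x : Fin (m + 1) → ℤ) (r : Fin m) :
    (blockMat p o k l X Y Z).mulVec x r.castSucc =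
      p ^ diagExp o k l r * x r.castSucc
        + p * ∑ c, rowCoeff o k l X Y Z r c * x c.castSucc + x (Fin.last m) := by
  simp only [Matrix.mulVec, dotProduct, Fin.sum_univ_castSucc, blockMat_castSucc_castSucc,
    blockMat_last, one_mul, add_mul, Finset.sum_add_distrib, ite_mul, zero_mul,
    Finset.sum_ite_eq, Finset.mem_univ, if_true, Finset.mul_sum, mul_assoc]

lemma blockMat_mulVec_last (x : Fin (m + 1) → ℤ) :
    (blockMat p o k l X Y Z).mulVec x (Fin.last m) = x (Fin.last m) := by
  simp [Matrix.mulVec, dotProduct, Fin.sum_univ_castSucc, blockMat_last_castSucc, blockMat_last]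

/-- The vanishing conditions on the rows of an upper triangular matrix. -/
structure Triangular {R : Type*} [Zero R] (o k l : Fin m) (X Y Z : Fin m → R) : Prop where
  left : ∀ j, j ≤ o → X j = 0
  mid : ∀ j, j ≤ k → Y j = 0
  right : ∀ j, j ≤ l → Z j = 0

lemma sums_of_eq_mul (hok : o < k) (hkl : k < l) (hT : Triangular o k l X Y Z)
    {x ω : Fin m → ℤ} (hx : ∀ r, r ≠ o → r ≠ k → r ≠ l → x r = p * ω r) :
    ∑ c, Z c * x c = p * ∑ c, Z c * ω c ∧
    ∑ c, Y c * x c = p * (∑ c, Y c * ω c - Y l * ω l) + Y l * x l ∧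
    ∑ c, X c * x c =
      p * (∑ c, X c * ω c - X k * ω k - X l * ω l) + X k * x k + X l * x l := by
  have hXo := hT.left o le_rfl
  have hYo := hT.mid o hok.le
  have hYk := hT.mid k le_rfl
  have hZo := hT.right o (hok.trans hkl).le
  have hZk := hT.right k hkl.le
  have hZl := hT.right l le_rfl
  refine ⟨?_, ?_, ?_⟩
  · rw [Finset.mul_sum]
    refine Finset.sum_congr rfl fun c _ => ?_
    by_cases h1 : c = o
    · simp [h1, hZo]
    by_cases h2 : c = k
    · simp [h2, hZk]
    by_cases h3 : c = l
    · simp [h3, hZl]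
    rw [hx c h1 h2 h3]; ring
  · have : ∀ c, Y c * x c = p * (Y c * ω c) +
        (if c = l then Y l * x l - p * (Y l * ω l) else 0) := by
      intro c
      by_cases h1 : c = o
      · simp [h1, hYo, (hok.trans hkl).ne]
      by_cases h2 : c = k
      · simp [h2, hYk, hkl.ne]
      by_cases h3 : c = l
      · simp [h3]
      rw [hx c h1 h2 h3]; simp [h3]; ring
    rw [Finset.sum_congr rfl fun c _ => this c, Finset.sum_add_distrib, ← Finset.mul_sum]
    simp only [Finset.sum_ite_eq', Finset.mem_univ, if_true]
    ring
  · have : ∀ c, X c * x c = p * (X c * ω c) +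
        ((if c = k then X k * x k - p * (X k * ω k) else 0) +
        (if c = l then X l * x l - p * (X l * ω l) else 0)) := by
      intro c
      by_cases h1 : c = o
      · simp [h1, hXo, (hok.trans hkl).ne, hok.ne]
      by_cases h2 : c = k
      · simp [h2, hkl.ne]
      by_cases h3 : c = l
      · simp [h3, hkl.ne']
      rw [hx c h1 h2 h3]; simp [h3, h2]; ring
    rw [Finset.sum_congr rfl fun c _ => this c, Finset.sum_add_distrib,
      Finset.sum_add_distrib, ← Finset.mul_sum]
    simp only [Finset.sum_ite_eq', Finset.mem_univ, if_true]
    ring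

lemma exists_solution_iff (hp : p ≠ 0) (hok : o < k) (hkl : k < l)
    (hT : Triangular o k l X Y Z) (ω : Fin m → ℤ) :
    (∃ x : Fin m → ℤ, ∀ r, p ^ diagExp o k l r * x r
        + p * ∑ c, rowCoeff o k l X Y Z r c * x c = p ^ 2 * ω r) ↔
      ∃ t, Y l * (ω l - ∑ c, Z c * ω c) = p * t ∧
        p ∣ X k * (ω k - (∑ c, Y c * ω c - Y l * ω l) - t)
          + X l * (ω l - ∑ c, Z c * ω c) := by
  have hol := hok.trans hkl
  have eo : ∀ c, rowCoeff o k l X Y Z o c = X c := by simp [rowCoeff]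
  have ek : ∀ c, rowCoeff o k l X Y Z k c = Y c := by simp [rowCoeff, hok.ne']
  have el : ∀ c, rowCoeff o k l X Y Z l c = Z c := by
    simp [rowCoeff, hol.ne', hkl.ne']
  have dO : diagExp o k l o = 2 := by simp [diagExp]
  have dk : diagExp o k l k = 2 := by simp [diagExp]
  have dl : diagExp o k l l = 2 := by simp [diagExp]
  constructor
  · rintro ⟨x, hx⟩
    have hgen : ∀ r, r ≠ o → r ≠ k → r ≠ l → x r = p * ω r := by
      intro r h1 h2 h3
      have := hx r
      simp only [diagExp, rowCoeff, h1, h2, h3, or_self, if_false, zero_mul,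
        Finset.sum_const_zero, mul_zero, add_zero, pow_one] at this
      exact mul_left_cancel₀ hp (by linear_combination this)
    obtain ⟨s1, s2, s3⟩ := sums_of_eq_mul hok hkl hT hgen
    have r1 := hx o
    have r2 := hx k
    have r3 := hx l
    simp only [eo, ek, el, dO, dk, dl] at r1 r2 r3
    rw [s3] at r1
    rw [s2] at r2
    rw [s1] at r3
    have hp2 : p ^ 2 ≠ 0 := pow_ne_zero 2 hp
    have xl : x l = ω l - ∑ c, Z c * ω c := mul_left_cancel₀ hp2 (by linear_combination r3)
    refine ⟨ω k - (∑ c, Y c * ω c - Y l * ω l) - x k, ?_, ?_⟩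
    · rw [← xl]
      exact mul_left_cancel₀ hp (by linear_combination r2)
    · rw [← xl]
      refine ⟨ω o - x o - (∑ c, X c * ω c - X k * ω k - X l * ω l), ?_⟩
      exact mul_left_cancel₀ hp (by linear_combination r1)
  · rintro ⟨t, ht, s, hs⟩
    set xl := ω l - ∑ c, Z c * ω c with hxl
    set xk := ω k - (∑ c, Y c * ω c - Y l * ω l) - t with hxk
    set xo := ω o - s - (∑ c, X c * ω c - X k * ω k - X l * ω l) with hxo
    let x : Fin m → ℤ := fun r =>
      if r = o then xo else if r = k then xk else if r = l then xl else p * ω r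
    have vo : x o = xo := by simp [x]
    have vk : x k = xk := by simp [x, hok.ne']
    have vl : x l = xl := by simp [x, hol.ne', hkl.ne']
    have hgen : ∀ r, r ≠ o → r ≠ k → r ≠ l → x r = p * ω r := by
      intro r h1 h2 h3; simp [x, h1, h2, h3]
    obtain ⟨s1, s2, s3⟩ := sums_of_eq_mul hok hkl hT hgen
    refine ⟨x, fun r => ?_⟩
    by_cases h1 : r = o
    · subst h1; simp only [eo, dO]; rw [s3, vo, vk, vl, hxo]; linear_combination p * hs
    by_cases h2 : r = k
    · subst h2; simp only [ek, dk]; rw [s2, vk, vl, hxk]; linear_combination p * ht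
    by_cases h3 : r = l
    · subst h3; simp only [el, dl]; rw [s1, vl, hxl]; ring
    rw [hgen r h1 h2 h3]
    simp only [diagExp, rowCoeff, h1, h2, h3, or_self, if_false, zero_mul,
        Finset.sum_const_zero, mul_zero, add_zero, pow_one]
    ring

lemma blockMat_mul_eq (i j r : Fin m) :
    blockMat p o k l X Y Z r.castSucc i.castSucc * blockMat p o k l X Y Z r.castSucc j.castSucc
      = p ^ 2 * (((if r = i then p ^ (diagExp o k l r - 1) else 0) + rowCoeff o k l X Y Z r i)
        * ((if r = j then p ^ (diagExp o k l r - 1) else 0) + rowCoeff o k l X Y Z r j)) := by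
  have : p ^ diagExp o k l r = p * p ^ (diagExp o k l r - 1) := by
    rw [← pow_succ']; congr 1; unfold diagExp; split_ifs <;> rfl
  rw [blockMat_castSucc_castSucc, blockMat_castSucc_castSucc, this]
  split_ifs <;> ring

/-- Closure of the column span under products, in terms of the rows `X`, `Y`, `Z`. -/
lemma blockMat_closed_iff (hp : p ≠ 0) (hok : o < k) (hkl : k < l)
    (hT : Triangular o k l X Y Z) :
    (∀ i j : Fin (m + 1), ∃ x : Fin (m + 1) → ℤ, (blockMat p o k l X Y Z).mulVec x =
      fun r => blockMat p o k l X Y Z r i * blockMat p o k l X Y Z r j) ↔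
    ∀ i j : Fin m, ∃ t, Y l * (((if l = i then p else 0) + Z i) * ((if l = j then p else 0) + Z j)
          - if i = j then Z i else 0) = p * t ∧
        p ∣ X k * (((if k = i then p else 0) + Y i) * ((if k = j then p else 0) + Y j)
            - (if i = j then if i = l then 0 else Y i else 0) - t)
          + X l * (((if l = i then p else 0) + Z i) * ((if l = j then p else 0) + Z j)
            - if i = j then Z i else 0) := by
  have hol := hok.trans hkl
  have key : ∀ i j : Fin m, (∃ x : Fin (m + 1) → ℤ, (blockMat p o k l X Y Z).mulVec x =
      fun r => blockMat p o k l X Y Z r i.castSucc * blockMat p o k l X Y Z r j.castSucc) ↔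
      ∃ t, Y l * (((if l = i then p else 0) + Z i) * ((if l = j then p else 0) + Z j)
          - if i = j then Z i else 0) = p * t ∧
        p ∣ X k * (((if k = i then p else 0) + Y i) * ((if k = j then p else 0) + Y j)
            - (if i = j then if i = l then 0 else Y i else 0) - t)
          + X l * (((if l = i then p else 0) + Z i) * ((if l = j then p else 0) + Z j)
            - if i = j then Z i else 0) := by
    intro i j
    set ω : Fin m → ℤ := fun r =>
      ((if r = i then p ^ (diagExp o k l r - 1) else 0) + rowCoeff o k l X Y Z r i)
        * ((if r = j then p ^ (diagExp o k l r - 1) else 0) + rowCoeff o k l X Y Z r j) with hω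
    have step : (∃ x : Fin (m + 1) → ℤ, (blockMat p o k l X Y Z).mulVec x =
        fun r => blockMat p o k l X Y Z r i.castSucc * blockMat p o k l X Y Z r j.castSucc) ↔
        (∃ x : Fin m → ℤ, ∀ r, p ^ diagExp o k l r * x r
          + p * ∑ c, rowCoeff o k l X Y Z r c * x c = p ^ 2 * ω r) := by
      constructor
      · rintro ⟨x, hx⟩
        have h0 := congrFun hx (Fin.last m)
        rw [blockMat_mulVec_last] at h0
        simp only [blockMat_last_castSucc, mul_zero] at h0
        refine ⟨fun r => x r.castSucc, fun r => ?_⟩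
        have := congrFun hx r.castSucc
        rw [blockMat_mulVec_castSucc, h0] at this
        simp only [blockMat_mul_eq] at this
        rw [← this]; ring
      · rintro ⟨x, hx⟩
        refine ⟨Fin.snoc x 0, ?_⟩
        funext r
        cases r using Fin.lastCases with
        | last => rw [blockMat_mulVec_last]; simp [blockMat_last_castSucc]
        | cast r =>
          rw [blockMat_mulVec_castSucc, blockMat_mul_eq]
          simp only [Fin.snoc_castSucc, Fin.snoc_last, add_zero]
          exact hx r
    have ωl : ω l = ((if l = i then p else 0) + Z i) * ((if l = j then p else 0) + Z j) := by
      simp [hω, rowCoeff, diagExp, hol.ne', hkl.ne']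
    have ωk : ω k = ((if k = i then p else 0) + Y i) * ((if k = j then p else 0) + Y j) := by
      simp [hω, rowCoeff, diagExp, hok.ne']
    have hgen : ∀ r, r ≠ o → r ≠ k → r ≠ l → ω r = if r = i then if r = j then 1 else 0 else 0 := by
      intro r h1 h2 h3
      simp only [hω, rowCoeff, diagExp, h1, h2, h3, or_self, if_false, add_zero, tsub_self, pow_zero]
      split_ifs <;> rfl
    clear_value ω
    clear hω
    have hZ : ∑ c, Z c * ω c = if i = j then Z i else 0 := by
      have : ∀ c, Z c * ω c = if c = i then if i = j then Z i else 0 else 0 := by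
        intro c
        by_cases h1 : c ≤ l
        · have := hT.right c h1
          grind
        · rw [hgen c (by omega) (by omega) (by omega)]
          grind
      rw [Finset.sum_congr rfl fun c _ => this c]; simp
    have hY : ∑ c, Y c * ω c - Y l * ω l = if i = j then if i = l then 0 else Y i else 0 := by
      have : ∀ c, Y c * ω c = (if c = i then if i = j then if i = l then 0 else Y i else 0 else 0)
          + if c = l then Y l * ω l else 0 := by
        intro c
        by_cases h0 : c = l
        · grind
        by_cases h1 : c ≤ k
        · have := hT.mid c h1
          grind
        · rw [hgen c (by omega) (by omega) h0]
          grind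
      rw [Finset.sum_congr rfl fun c _ => this c, Finset.sum_add_distrib]; simp
    rw [step, exists_solution_iff hp hok hkl hT, hZ, hY, ωl, ωk]
  constructor
  · intro h i j
    exact (key i j).1 (h _ _)
  · intro h i j
    have hcol : ∀ c, (blockMat p o k l X Y Z).mulVec (Pi.single c 1)
        = fun r => blockMat p o k l X Y Z r c := by
      intro c; ext r; simp
    cases i using Fin.lastCases with
    | last => exact ⟨Pi.single j 1, by rw [hcol]; simp [blockMat_last]⟩
    | cast i =>
      cases j using Fin.lastCases with
      | last => exact ⟨Pi.single i.castSucc 1, by rw [hcol]; simp [blockMat_last]⟩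
      | cast j => exact (key i j).2 (h i j)

end Matrix

/-- The condition on the rows of a block matrix, reduced modulo `p`, which expresses closure
under products; `a` and `b` are the entries `X k` and `X l` of the first row. -/
def RowCond {ι F : Type*} [DecidableEq ι] [Field F] (l : ι) (a b : F) (Y Z : ι → F) : Prop :=
  (Y l = 0 ∧ ∀ i j, a * (Y i * Y j - if i = j then Y i else 0)
      + b * (Z i * Z j - if i = j then Z i else 0) = 0) ∨
  (Y l ≠ 0 ∧ a = 0 ∧ ∀ i j, Z i * Z j = if i = j then Z i else 0)

section Reduction

variable {m p : ℕ} [Fact p.Prime] {o k l : Fin m} {X Y Z : Fin m → ZMod p}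

/-- The representatives in `[0, p)` of a vector modulo `p`. -/
def lift (v : Fin m → ZMod p) (j : Fin m) : ℤ := (v j).val

lemma cast_lift (v : Fin m → ZMod p) (j : Fin m) : ((lift v j : ℤ) : ZMod p) = v j := by
  simp [lift]

omit [Fact p.Prime] in
lemma lift_nonneg (v : Fin m → ZMod p) (j : Fin m) : 0 ≤ lift v j :=
  Int.natCast_nonneg _

lemma lift_lt (v : Fin m → ZMod p) (j : Fin m) : lift v j < p :=
  Int.ofNat_lt.2 (ZMod.val_lt (v j))

lemma Triangular.lift (hT : Triangular o k l X Y Z) :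
    Triangular o k l (lift X) (lift Y) (lift Z) :=
  ⟨fun j h => by simp [IrrSubring.lift, hT.left j h],
    fun j h => by simp [IrrSubring.lift, hT.mid j h],
    fun j h => by simp [IrrSubring.lift, hT.right j h]⟩

lemma blockMat_lift_closed_iff (hok : o < k) (hkl : k < l) (hT : Triangular o k l X Y Z) :
    (∀ i j : Fin (m + 1), ∃ x : Fin (m + 1) → ℤ,
      (blockMat p o k l (lift X) (lift Y) (lift Z)).mulVec x = fun r =>
        blockMat p o k l (lift X) (lift Y) (lift Z) r i
          * blockMat p o k l (lift X) (lift Y) (lift Z) r j) ↔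
    RowCond l (X k) (X l) Y Z := by
  have hp0 : (p : ℤ) ≠ 0 := by exact_mod_cast (Fact.out : p.Prime).ne_zero
  rw [blockMat_closed_iff hp0 hok hkl hT.lift]
  have dvd_iff : ∀ e : ℤ, (p : ℤ) ∣ e ↔ (e : ZMod p) = 0 := fun e =>
    (ZMod.intCast_zmod_eq_zero_iff_dvd e p).symm
  have hpz : ((p : ℤ) : ZMod p) = 0 := by simp
  have castC : ∀ i j, (((((if l = i then (p : ℤ) else 0) + lift Z i)
      * ((if l = j then (p : ℤ) else 0) + lift Z j) - if i = j then lift Z i else 0) : ℤ) : ZMod p)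
      = Z i * Z j - if i = j then Z i else 0 := by
    intro i j
    push_cast [apply_ite (Int.cast : ℤ → ZMod p), cast_lift]
    simp
  have castD : Y l = 0 → ∀ i j, (((((if k = i then (p : ℤ) else 0) + lift Y i)
      * ((if k = j then (p : ℤ) else 0) + lift Y j)
        - (if i = j then if i = l then 0 else lift Y i else 0)) : ℤ) : ZMod p)
      = Y i * Y j - if i = j then Y i else 0 := by
    intro h0 i j
    push_cast [apply_ite (Int.cast : ℤ → ZMod p), cast_lift]
    by_cases h : i = l
    · simp [h, h0]
    · simp [h]
  by_cases hY : Y l = 0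
  · have hYl : lift Y l = 0 := by simp [lift, hY]
    simp only [RowCond, hY, true_and, ne_eq, not_true_eq_false, false_and, or_false]
    refine forall_congr' fun i => forall_congr' fun j => ?_
    rw [hYl]
    constructor
    · rintro ⟨t, ht, h⟩
      have ht0 : t = 0 := by
        rw [zero_mul] at ht
        exact (mul_eq_zero.1 ht.symm).resolve_left hp0
      rw [ht0, sub_zero, dvd_iff, Int.cast_add, Int.cast_mul, Int.cast_mul, castC, castD hY,
        cast_lift, cast_lift] at h
      exact h
    · intro h
      refine ⟨0, by simp, ?_⟩
      rw [sub_zero, dvd_iff, Int.cast_add, Int.cast_mul, Int.cast_mul, castC, castD hY,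
        cast_lift, cast_lift]
      exact h
  · simp only [RowCond, hY, false_and, ne_eq, not_false_eq_true, true_and, false_or]
    constructor
    · intro h
      refine ⟨?_, ?_⟩
      · obtain ⟨t, ht, h⟩ := h l l
        have hZl := hT.lift.right l le_rfl
        simp only [hZl, if_true, add_zero, sub_zero, if_neg hkl.ne, zero_add] at ht h
        have ht' : t = lift Y l * p := mul_left_cancel₀ hp0 (by linear_combination -ht)
        rw [dvd_iff, ht'] at h
        push_cast [cast_lift] at h
        simpa [hY] using h
      · intro i j
        obtain ⟨t, ht, -⟩ := h i j
        have := congrArg (Int.cast : ℤ → ZMod p) ht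
        rw [Int.cast_mul, castC, Int.cast_mul, hpz, zero_mul, cast_lift] at this
        exact sub_eq_zero.1 ((mul_eq_zero.1 this).resolve_left hY)
    · rintro ⟨hX, hZ⟩ i j
      have hXk : lift X k = 0 := by simp [lift, hX]
      have hC := castC i j
      rw [hZ, sub_self, ← dvd_iff] at hC
      obtain ⟨s, hs⟩ := hC
      refine ⟨lift Y l * s, by rw [hs]; ring, ?_⟩
      rw [hXk, zero_mul, zero_add, hs]
      exact ⟨lift X l * s, by ring⟩

lemma isIrrSubringMatrix_blockMat_iff (hok : o < k) (hkl : k < l)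
    (hT : Triangular o k l X Y Z) :
    IsIrrSubringMatrix p (diagExp o k l) (blockMat p o k l (lift X) (lift Y) (lift Z)) ↔
      RowCond l (X k) (X l) Y Z := by
  rw [← blockMat_lift_closed_iff hok hkl hT]
  have hp0 : (0 : ℤ) < p := by exact_mod_cast (Fact.out : p.Prime).pos
  have hTl := hT.lift
  refine ⟨fun h => h.2.2.2.2, fun h => ⟨?_, ?_, blockMat_last, ?_, h⟩⟩
  · intro i j hij
    cases j using Fin.lastCases with
    | last => have := i.2; simp at hij; omega
    | cast j =>
      cases i using Fin.lastCases with
      | last => exact blockMat_last_castSucc j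
      | cast i =>
        rw [blockMat_castSucc_castSucc]
        have hji : j < i := by simpa using hij
        have : rowCoeff o k l (lift X) (lift Y) (lift Z) i j = 0 := by
          unfold rowCoeff
          split_ifs with h1 h2 h3
          · exact hTl.left j (by omega)
          · exact hTl.mid j (by omega)
          · exact hTl.right j (by omega)
          · rfl
        rw [this, if_neg hji.ne']; simp
  · intro i
    rw [blockMat_castSucc_castSucc]
    have : rowCoeff o k l (lift X) (lift Y) (lift Z) i i = 0 := by
      unfold rowCoeff
      split_ifs with h1 h2 h3
      · exact hTl.left i (by omega)
      · exact hTl.mid i (by omega)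
      · exact hTl.right i (by omega)
      · rfl
    rw [this]; simp
  · intro i j hij
    rw [blockMat_castSucc_castSucc, if_neg (by rintro rfl; exact lt_irrefl _ hij), zero_add]
    refine ⟨dvd_mul_right _ _, ?_⟩
    have aux : ∀ v : Fin m → ZMod p, 0 ≤ (p : ℤ) * lift v j ∧ (p : ℤ) * lift v j < (p : ℤ) ^ 2 :=
      fun v => ⟨mul_nonneg hp0.le (lift_nonneg v j), by
        rw [pow_two]; exact mul_lt_mul_of_pos_left (lift_lt v j) hp0⟩
    unfold rowCoeff diagExp
    split_ifs with h1 h2 h3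
    all_goals first | exact aux _ | (exfalso; tauto) | simpa using hp0

/-- Every irreducible subring matrix is a block matrix. -/
lemma exists_eq_blockMat (hok : o < k) (hkl : k < l) {A : Matrix (Fin (m + 1)) (Fin (m + 1)) ℤ}
    (hA : IsIrrSubringMatrix p (diagExp o k l) A) :
    ∃ X Y Z : Fin m → ZMod p, Triangular o k l X Y Z ∧
      blockMat p o k l (lift X) (lift Y) (lift Z) = A := by
  obtain ⟨h1, h2, h3, h4, -⟩ := hA
  have hp0 : (0 : ℤ) < p := by exact_mod_cast (Fact.out : p.Prime).pos
  have row : ∀ r, diagExp o k l r = 2 → ∃ v : Fin m → ZMod p, (∀ j, j ≤ r → v j = 0) ∧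
      ∀ j, r < j → A r.castSucc j.castSucc = p * lift v j := by
    intro r hr
    refine ⟨fun j => if j ≤ r then 0 else ((A r.castSucc j.castSucc / p : ℤ) : ZMod p),
      fun j hj => if_pos hj, fun j hj => ?_⟩
    obtain ⟨⟨c, hc⟩, hb, hlt⟩ := h4 r j hj
    rw [hr] at hlt
    rw [hc] at hb hlt
    have hc0 : 0 ≤ c := nonneg_of_mul_nonneg_right hb hp0
    have hcp : c < p := by nlinarith
    simp only [lift, if_neg (not_le.2 hj), hc, Int.mul_ediv_cancel_left _ hp0.ne',
      ZMod.val_intCast, Int.emod_eq_of_lt hc0 hcp]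
  have hol := hok.trans hkl
  obtain ⟨X, hX0, hX⟩ := row o (by simp [diagExp])
  obtain ⟨Y, hY0, hY⟩ := row k (by simp [diagExp])
  obtain ⟨Z, hZ0, hZ⟩ := row l (by simp [diagExp])
  have hT : Triangular o k l X Y Z := ⟨hX0, hY0, hZ0⟩
  have hTl := hT.lift
  refine ⟨X, Y, Z, hT, ?_⟩
  ext i j
  cases j using Fin.lastCases with
  | last => rw [h3, blockMat_last]
  | cast j =>
    cases i using Fin.lastCases with
    | last => rw [blockMat_last_castSucc, h1 _ _ (by simp)]
    | cast i =>
      rw [blockMat_castSucc_castSucc]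
      rcases lt_trichotomy i j with hij | hij | hij
      · rw [if_neg hij.ne, zero_add]
        unfold rowCoeff
        split_ifs with e1 e2 e3
        · rw [e1, hX j (e1 ▸ hij)]
        · rw [e2, hY j (e2 ▸ hij)]
        · rw [e3, hZ j (e3 ▸ hij)]
        · obtain ⟨⟨c, hc⟩, hb, hlt⟩ := h4 i j hij
          have he : diagExp o k l i = 1 := by simp [diagExp, e1, e2, e3]
          rw [he, pow_one, hc] at hlt
          rw [hc] at hb
          have : c = 0 := by nlinarith [nonneg_of_mul_nonneg_right hb hp0]
          rw [hc, this]
      · subst hij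
        have : rowCoeff o k l (lift X) (lift Y) (lift Z) i i = 0 := by
          unfold rowCoeff
          split_ifs with h1 h2 h3
          · exact hTl.left i (by omega)
          · exact hTl.mid i (by omega)
          · exact hTl.right i (by omega)
          · rfl
        rw [this, h2]; simp
      · have : rowCoeff o k l (lift X) (lift Y) (lift Z) i j = 0 := by
          unfold rowCoeff
          split_ifs with h1 h2 h3
          · exact hTl.left j (by omega)
          · exact hTl.mid j (by omega)
          · exact hTl.right j (by omega)
          · rfl
        rw [this, if_neg hij.ne', h1 _ _ (by simpa using hij)]; simp

lemma blockMat_lift_injective (hok : o < k) (hkl : k < l) {X' Y' Z' : Fin m → ZMod p}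
    (h : blockMat p o k l (lift X) (lift Y) (lift Z)
      = blockMat p o k l (lift X') (lift Y') (lift Z')) : X = X' ∧ Y = Y' ∧ Z = Z' := by
  have hp0 : (p : ℤ) ≠ 0 := by exact_mod_cast (Fact.out : p.Prime).ne_zero
  have key : ∀ r c, rowCoeff o k l (lift X) (lift Y) (lift Z) r c
      = rowCoeff o k l (lift X') (lift Y') (lift Z') r c := by
    intro r c
    have := congrFun (congrFun h r.castSucc) c.castSucc
    rw [blockMat_castSucc_castSucc, blockMat_castSucc_castSucc] at this
    exact mul_left_cancel₀ hp0 (add_left_cancel this)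
  have inj : ∀ v w : Fin m → ZMod p, (∀ c, lift v c = lift w c) → v = w := by
    intro v w hvw
    funext c
    rw [← cast_lift v, hvw, cast_lift]
  refine ⟨inj _ _ fun c => ?_, inj _ _ fun c => ?_, inj _ _ fun c => ?_⟩
  · simpa [rowCoeff] using key o c
  · simpa [rowCoeff, hok.ne'] using key k c
  · simpa [rowCoeff, hkl.ne', (hok.trans hkl).ne'] using key l c

lemma gMat_diagExp_eq_ncard (hok : o < k) (hkl : k < l) :
    gMat p (diagExp o k l) = {t : (Fin m → ZMod p) × (Fin m → ZMod p) × (Fin m → ZMod p) |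
      Triangular o k l t.1 t.2.1 t.2.2 ∧ RowCond l (t.1 k) (t.1 l) t.2.1 t.2.2}.ncard := by
  rw [gMat, ← Nat.card_coe_set_eq]
  symm
  refine Nat.card_eq_of_bijective (fun t => ⟨blockMat p o k l (lift t.1.1) (lift t.1.2.1)
    (lift t.1.2.2), (isIrrSubringMatrix_blockMat_iff hok hkl t.2.1).2 t.2.2⟩) ⟨?_, ?_⟩
  · rintro ⟨⟨X, Y, Z⟩, h⟩ ⟨⟨X', Y', Z'⟩, h'⟩ e
    obtain ⟨rfl, rfl, rfl⟩ := blockMat_lift_injective hok hkl (Subtype.ext_iff.1 e)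
    rfl
  · rintro ⟨A, hA⟩
    obtain ⟨X, Y, Z, hT, rfl⟩ := exists_eq_blockMat hok hkl hA
    exact ⟨⟨(X, Y, Z), hT, (isIrrSubringMatrix_blockMat_iff hok hkl hT).1 hA⟩, rfl⟩

end Reduction

section Counting

variable {ι F : Type*} [Fintype ι] [DecidableEq ι] [Field F] [Fintype F] [DecidableEq F]

omit [Field F] [DecidableEq F] in
lemma ncard_prescribed (S : Finset ι) (c : ι → F) :
    {v : ι → F | ∀ j ∈ S, v j = c j}.ncard = Fintype.card F ^ Sᶜ.card := by
  have : {v : ι → F | ∀ j ∈ S, v j = c j} =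
      (Fintype.piFinset fun j => if j ∈ S then {c j} else (Finset.univ : Finset F)) := by
    ext v
    simp only [Set.mem_ofPred_eq, Finset.mem_coe, Fintype.mem_piFinset]
    refine forall_congr' fun j => ?_
    by_cases h : j ∈ S <;> simp [h]
  rw [this, Set.ncard_coe_finset, Fintype.card_piFinset,
    ← Finset.prod_subset (Finset.subset_univ Sᶜ)]
  · rw [Finset.prod_congr rfl (g := fun _ => Fintype.card F), Finset.prod_const]
    intro j hj
    rw [if_neg (Finset.mem_compl.1 hj), Finset.card_univ]
  · intro j _ hj
    rw [Finset.mem_compl, not_not] at hj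
    simp [hj]

omit [DecidableEq F] in
lemma ncard_supported (S : Finset ι) :
    {v : ι → F | ∀ j, j ∉ S → v j = 0}.ncard = Fintype.card F ^ S.card := by
  simpa using ncard_prescribed Sᶜ (fun _ => (0 : F))

lemma ncard_setOf_prod {α β : Type*} [Fintype α] [Finite β] (P : α → β → Prop) :
    {x : α × β | P x.1 x.2}.ncard = ∑ a, {b | P a b}.ncard := by
  simp only [← Nat.card_coe_set_eq]
  rw [← Nat.card_sigma]
  exact Nat.card_congr
    { toFun := fun x => ⟨x.1.1, x.1.2, x.2⟩
      invFun := fun x => ⟨(x.1, x.2.1), x.2.2⟩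
      left_inv := fun _ => rfl
      right_inv := fun _ => rfl }

/-- The vectors supported on `S` whose entries are orthogonal idempotents. -/
def orthIdem (F : Type*) [Field F] (S : Finset ι) : Set (ι → F) :=
  {v | (∀ j, j ∉ S → v j = 0) ∧ ∀ i j, v i * v j = if i = j then v i else 0}

omit [Fintype ι] [Fintype F] [DecidableEq F] in
lemma single_one_mul_single_one (i a b : ι) :
    (Pi.single i 1 : ι → F) a * (Pi.single i 1 : ι → F) b =
      if a = b then (Pi.single i 1 : ι → F) a else 0 := by
  simp only [Pi.single_apply]; grind

omit [Fintype ι] [Fintype F] [DecidableEq F] in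
lemma eq_single_of_ne_zero {v : ι → F} (h : ∀ i j, v i * v j = if i = j then v i else 0)
    {i : ι} (hi : v i ≠ 0) : v = Pi.single i 1 := by
  funext j
  by_cases hj : j = i
  · subst hj
    have := h j j
    rw [if_pos rfl] at this
    simpa [hi] using this
  · have := h i j
    rw [if_neg (Ne.symm hj)] at this
    simpa [hi, hj] using this

omit [Fintype F] [DecidableEq F] in
lemma ncard_orthIdem (S : Finset ι) : (orthIdem F S).ncard = 1 + S.card := by
  have : orthIdem F S = insert 0 ((fun i => (Pi.single i 1 : ι → F)) '' S) := by
    ext v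
    simp only [orthIdem, Set.mem_ofPred_eq, Set.mem_insert_iff, Set.mem_image, Finset.mem_coe]
    constructor
    · rintro ⟨h0, h⟩
      by_cases hv : v = 0
      · exact Or.inl hv
      · obtain ⟨i, hi⟩ := Function.ne_iff.1 hv
        refine Or.inr ⟨i, ?_, (eq_single_of_ne_zero h hi).symm⟩
        by_contra hS
        exact hi (h0 i hS)
    · rintro (rfl | ⟨i, hi, rfl⟩)
      · simp
      · refine ⟨fun j hj => ?_, fun a b => single_one_mul_single_one i a b⟩
        rw [Pi.single_eq_of_ne]
        rintro rfl
        exact hj hi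
  rw [this, Set.ncard_insert_of_notMem, Set.ncard_image_of_injective, Set.ncard_coe_finset,
    add_comm]
  · intro i j hij
    by_contra hne
    have := congrFun hij i
    simp [hne] at this
  · rintro ⟨i, -, hi⟩
    have := congrFun hi i
    simp at this

/-- The pairs of vectors, the first supported on `M ∪ R` and the second on `R`, whose entries
are orthogonal idempotents with respect to the form `y * y' + s * z * z'`. -/
def formIdem (s : F) (M R : Finset ι) : Set ((ι → F) × (ι → F)) :=
  {v | (∀ j, j ∉ M ∪ R → v.1 j = 0) ∧ (∀ j, j ∉ R → v.2 j = 0) ∧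
    ∀ i j, (v.1 i * v.1 j - if i = j then v.1 i else 0)
      + s * (v.2 i * v.2 j - if i = j then v.2 i else 0) = 0}

/-- The points `(y, z)` of the conic `y² - y + s (z² - z) = 0` with `y² + s z² ≠ 0`. -/
def conicPts (s : F) : Set (F × F) :=
  {u | u.1 * u.1 - u.1 + s * (u.2 * u.2 - u.2) = 0 ∧ u.1 * u.1 + s * (u.2 * u.2) ≠ 0}

omit [DecidableEq ι] [Fintype ι] [Fintype F] in
lemma ncard_conicPts [Finite F] (s : F) :
    (conicPts s).ncard = (conicPts s \ {(1, 1)}).ncard + if s = -1 then 0 else 1 := by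
  by_cases hs : s = -1
  · rw [if_pos hs, add_zero, Set.sdiff_singleton_eq_self]
    rintro ⟨-, h⟩
    simp [hs] at h
  · have h1 : ((1, 1) : F × F) ∈ conicPts s := by
      refine ⟨by simp, ?_⟩
      intro h
      exact hs (by linear_combination h)
    rw [if_neg hs, Set.ncard_sdiff_singleton_add_one h1]

/-- The coordinatewise pair of vectors with entry `u` at `i`. -/
def onePt (i : ι) (u : F × F) : (ι → F) × (ι → F) := (Pi.single i u.1, Pi.single i u.2)

/-- The pair of vectors with entry `u` at `i` and `1 - u` at `j`. -/
def twoPt (i j : ι) (u : F × F) : (ι → F) × (ι → F) :=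
  (fun r => if r = i then u.1 else if r = j then 1 - u.1 else 0,
    fun r => if r = i then u.2 else if r = j then 1 - u.2 else 0)

omit [Fintype ι] [DecidableEq ι] [Fintype F] [DecidableEq F] in
/-- A nonzero idempotent orthogonal to an anisotropic idempotent `(y, z)` is `(1 - y, 1 - z)`. -/
lemma orthogonal_idempotent {s y z y' z' : F} (hs : s ≠ 0)
    (h : y * y - y + s * (z * z - z) = 0) (hn : y * y + s * (z * z) ≠ 0)
    (h' : y' * y' - y' + s * (z' * z' - z') = 0) (ho : y * y' + s * (z * z') = 0)
    (h0 : ¬ (y' = 0 ∧ z' = 0)) :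
    y' = 1 - y ∧ z' = 1 - z ∧ y' * y' + s * (z' * z') ≠ 0 := by
  set w := y * y + s * (z * z) with hw
  set t := (y * z' - z * y') / w with ht
  have htw : t * w = y * z' - z * y' := div_mul_cancel₀ _ hn
  have ey : y' = -(s * z * t) := by
    apply mul_right_cancel₀ hn
    linear_combination s * z * htw + y * ho + y' * hw
  have ez : z' = y * t := by
    apply mul_right_cancel₀ hn
    linear_combination (-y) * htw + z * ho + z' * hw
  have ht0 : t ≠ 0 := by
    intro h; apply h0; rw [ey, ez, h]; simp
  have htw' : t * w = y - z := by
    apply mul_left_cancel₀ (mul_ne_zero hs ht0)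
    rw [ey, ez] at h'
    linear_combination h' + s * t ^ 2 * hw
  refine ⟨?_, ?_, ?_⟩
  · rw [ey]
    apply mul_right_cancel₀ hn
    linear_combination (-s * z) * htw' - (1 - y) * (hw + h) + h
  · rw [ez]
    apply mul_right_cancel₀ hn
    linear_combination y * htw' - (1 - z) * (hw + h) + h
  · have : y' * y' + s * (z' * z') = t ^ 2 * s * w := by rw [ey, ez, hw]; ring
    rw [this]
    exact mul_ne_zero (mul_ne_zero (pow_ne_zero 2 ht0) hs) hn

omit [Fintype ι] [Fintype F] [DecidableEq F] in
lemma single_prod_mem_formIdem {s : F} {M R : Finset ι}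
    {i : ι} (hi : i ∈ M) {Z : ι → F} (hZ : Z ∈ orthIdem F R) :
    (Pi.single i 1, Z) ∈ formIdem s M R := by
  refine ⟨fun j hj => ?_, hZ.1, fun a b => ?_⟩
  · change (Pi.single i 1 : ι → F) j = 0
    rw [Pi.single_eq_of_ne]
    rintro rfl
    exact hj (Finset.mem_union_left _ hi)
  · simp only
    rw [single_one_mul_single_one, hZ.2 a b]
    simp

omit [Fintype ι] [Fintype F] [DecidableEq F] in
lemma onePt_mem_formIdem {s : F} {M R : Finset ι} {i : ι} (hi : i ∈ R) {u : F × F}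
    (hu : u ∈ conicPts s) : onePt i u ∈ formIdem s M R := by
  have := hu.1
  refine ⟨fun j hj => ?_, fun j hj => ?_, fun a b => ?_⟩
  · have : j ≠ i := by rintro rfl; exact hj (Finset.mem_union_right _ hi)
    simp [onePt, this]
  · have : j ≠ i := by rintro rfl; exact hj hi
    simp [onePt, this]
  · simp only [onePt, Pi.single_apply]
    split_ifs <;> simp_all

omit [Fintype ι] [Fintype F] [DecidableEq F] in
lemma twoPt_mem_formIdem {s : F} {M R : Finset ι} {i j : ι} (hi : i ∈ R) (hj : j ∈ R)
    {u : F × F} (hu : u ∈ conicPts s) : twoPt i j u ∈ formIdem s M R := by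
  have := hu.1
  refine ⟨fun r hr => ?_, fun r hr => ?_, fun a b => ?_⟩
  · have h1 : r ≠ i := by rintro rfl; exact hr (Finset.mem_union_right _ hi)
    have h2 : r ≠ j := by rintro rfl; exact hr (Finset.mem_union_right _ hj)
    simp [twoPt, h1, h2]
  · have h1 : r ≠ i := by rintro rfl; exact hr hi
    have h2 : r ≠ j := by rintro rfl; exact hr hj
    simp [twoPt, h1, h2]
  · simp only [twoPt]
    grind

omit [Fintype ι] [DecidableEq ι] [Field F] [Fintype F] [DecidableEq F] in
lemma ext_pair {v w : (ι → F) × (ι → F)} (h : ∀ r, v.1 r = w.1 r ∧ v.2 r = w.2 r) : v = w :=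
  Prod.ext (funext fun r => (h r).1) (funext fun r => (h r).2)

/-- The isotropic part of `formIdem`. -/
def isoPart (s : F) (R : Finset ι) : Set ((ι → F) × (ι → F)) :=
  if s = -1 then (fun v => (v, v)) '' {v : ι → F | ∀ j, j ∉ R → v j = 0} else {0}

omit [Fintype ι] [DecidableEq ι] [Fintype F] in
lemma isoPart_spec {s : F} {R : Finset ι} {v : (ι → F) × (ι → F)} (hv : v ∈ isoPart s R) :
    (∀ j, j ∉ R → v.1 j = 0 ∧ v.2 j = 0) ∧
      (∀ j, v.1 j * v.1 j + s * (v.2 j * v.2 j) = 0) := by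
  unfold isoPart at hv
  split_ifs at hv with hs
  · obtain ⟨w, hw, rfl⟩ := hv
    exact ⟨fun j hj => ⟨hw j hj, hw j hj⟩, fun j => by rw [hs]; ring⟩
  · rw [Set.mem_singleton_iff.1 hv]
    simp

omit [Fintype ι] [Fintype F] in
lemma isoPart_subset {s : F} {M R : Finset ι} : isoPart s R ⊆ formIdem s M R := by
  intro v hv
  unfold isoPart at hv
  split_ifs at hv with hs
  · obtain ⟨w, hw, rfl⟩ := hv
    refine ⟨fun j hj => hw j fun h => hj (Finset.mem_union_right _ h), hw, fun a b => ?_⟩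
    simp only [hs]; ring
  · rw [Set.mem_singleton_iff.1 hv]
    simp [formIdem]

end Counting

section Conic

variable {ι F : Type*} [Fintype ι] [LinearOrder ι] [Field F] [Fintype F] [DecidableEq F]

omit [Fintype ι] [Fintype F] in
lemma formIdem_eq {s : F} (hs : s ≠ 0) {M R : Finset ι} (hd : Disjoint M R) :
    formIdem s M R =
      (fun x : ι × (ι → F) => ((Pi.single x.1 1 : ι → F), x.2)) '' ((M : Set ι) ×ˢ orthIdem F R) ∪
      (isoPart s R ∪
      ((fun x : ι × F × F => onePt x.1 x.2) '' ((R : Set ι) ×ˢ conicPts s) ∪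
      (fun x : (ι × ι) × F × F => twoPt x.1.1 x.1.2 x.2) ''
        (((R ×ˢ R).filter fun x => x.1 < x.2 : Finset (ι × ι)) ×ˢ
          (conicPts s \ {(1, 1)})))) := by
  apply subset_antisymm
  · rintro ⟨Y, Z⟩ ⟨hY, hZ, h⟩
    simp only at hY hZ h
    by_cases hM : ∃ i ∈ M, Y i ≠ 0
    · left
      obtain ⟨i, hi, hYi⟩ := hM
      have hiR : i ∉ R := Finset.disjoint_left.1 hd hi
      have hZi := hZ i hiR
      have h1 : Y = Pi.single i 1 := by
        funext j
        by_cases hj : j = i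
        · subst hj
          have := h j j
          simp only [if_true, hZi] at this
          have h2 : Y j * (Y j - 1) = 0 := by linear_combination this
          simpa [hYi, sub_eq_zero] using h2
        · have := h i j
          simp only [if_neg (Ne.symm hj), hZi] at this
          have h2 : Y i * Y j = 0 := by linear_combination this
          simpa [hYi, hj] using h2
      refine ⟨(i, Z), ⟨hi, hZ, fun a b => ?_⟩, by simp [h1]⟩
      have := h a b
      rw [h1, single_one_mul_single_one, sub_self, zero_add] at this
      exact sub_eq_zero.1 ((mul_eq_zero.1 this).resolve_left hs)
    · right
      push Not at hM
      have hYR : ∀ j, j ∉ R → Y j = 0 := by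
        intro j hj
        by_cases hjM : j ∈ M
        · exact hM j hjM
        · exact hY j (by simp [hj, hjM])
      have hself : ∀ j, Y j * Y j - Y j + s * (Z j * Z j - Z j) = 0 := fun j => by
        simpa using h j j
      have hoff : ∀ i j, i ≠ j → Y i * Y j + s * (Z i * Z j) = 0 := fun i j hij => by
        simpa [hij] using h i j
      by_cases hiso : ∀ j, Y j * Y j + s * (Z j * Z j) = 0
      · left
        have hlin : ∀ j, Y j = - (s * Z j) := fun j => by
          linear_combination hiso j - hself j
        unfold isoPart
        split_ifs with h1
        · exact ⟨Y, hYR, ext_pair fun r => ⟨rfl, by simp [hlin, h1]⟩⟩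
        · rw [Set.mem_singleton_iff]
          have hz : ∀ j, Z j = 0 := by
            intro j
            by_contra hzj
            apply h1
            have := hiso j
            rw [hlin] at this
            have h2 : (s * Z j * Z j) * (s + 1) = 0 := by linear_combination this
            have h3 := (mul_eq_zero.1 h2).resolve_left
              (mul_ne_zero (mul_ne_zero hs hzj) hzj)
            exact eq_neg_of_add_eq_zero_left h3
          exact ext_pair fun r => ⟨by simp [hlin, hz], by simp [hz]⟩
      · right
        push Not at hiso
        obtain ⟨i, hi⟩ := hiso
        have hiR : i ∈ R := by
          by_contra hc
          exact hi (by simp [hYR i hc, hZ i hc])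
        by_cases hone : ∀ j, j ≠ i → Y j = 0 ∧ Z j = 0
        · left
          refine ⟨(i, Y i, Z i), ⟨hiR, hself i, hi⟩, ext_pair fun r => ?_⟩
          by_cases hr : r = i
          · subst hr; simp [onePt]
          · simp [onePt, hr, hone r hr]
        · right
          push Not at hone
          obtain ⟨j, hji, hj0⟩ := hone
          have hj0' : ¬ (Y j = 0 ∧ Z j = 0) := fun hc => hj0 hc.1 hc.2
          have hjR : j ∈ R := by
            by_contra hc
            exact hj0' ⟨hYR j hc, hZ j hc⟩
          obtain ⟨eY, eZ, hnj⟩ := orthogonal_idempotent hs (hself i) hi (hself j)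
            (hoff i j hji.symm) hj0'
          have hrest : ∀ r, r ≠ i → r ≠ j → Y r = 0 ∧ Z r = 0 := by
            intro r hri hrj
            by_contra hc
            obtain ⟨fY, fZ, -⟩ := orthogonal_idempotent hs (hself i) hi (hself r)
              (hoff i r hri.symm) hc
            have := hoff j r hrj.symm
            rw [fY, fZ, ← eY, ← eZ] at this
            exact hnj this
          rcases lt_or_gt_of_ne hji with hlt | hlt
          · refine ⟨((j, i), Y j, Z j), ⟨by simp [hiR, hjR, hlt], ⟨hself j, hnj⟩, ?_⟩,
              ext_pair fun r => ?_⟩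
            · intro hc
              rw [Set.mem_singleton_iff, Prod.mk.injEq] at hc
              apply hi
              rw [show Y i = 0 by linear_combination -hc.1 + eY,
                show Z i = 0 by linear_combination -hc.2 + eZ]
              simp
            · by_cases hrj : r = j
              · simp [twoPt, hrj]
              by_cases hri : r = i
              · simp [twoPt, hri, hji.symm, eY, eZ]
              · simp [twoPt, hri, hrj, hrest r hri hrj]
          · refine ⟨((i, j), Y i, Z i), ⟨by simp [hiR, hjR, hlt], ⟨hself i, hi⟩, ?_⟩,
              ext_pair fun r => ?_⟩
            · intro hc
              rw [Set.mem_singleton_iff, Prod.mk.injEq] at hc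
              apply hj0'
              rw [eY, eZ, hc.1, hc.2]
              simp
            · by_cases hri : r = i
              · simp [twoPt, hri]
              by_cases hrj : r = j
              · simp [twoPt, hrj, hji, eY, eZ]
              · simp [twoPt, hri, hrj, hrest r hri hrj]
  · refine Set.union_subset ?_ (Set.union_subset isoPart_subset (Set.union_subset ?_ ?_))
    · rintro _ ⟨⟨i, Z⟩, ⟨hi, hZ⟩, rfl⟩
      exact single_prod_mem_formIdem hi hZ
    · rintro _ ⟨⟨i, u⟩, ⟨hi, hu⟩, rfl⟩
      exact onePt_mem_formIdem hi hu
    · rintro _ ⟨⟨⟨i, j⟩, u⟩, ⟨hij, hu⟩, rfl⟩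
      simp only [Finset.coe_filter, Finset.mem_product, Set.mem_ofPred_eq] at hij
      exact twoPt_mem_formIdem hij.1.1 hij.1.2 hu.1

omit [Fintype ι] in
lemma card_filter_lt (R : Finset ι) :
    ((R ×ˢ R).filter fun x => x.1 < x.2).card = R.card.choose 2 := by
  have h1 : (R.offDiag).card = 2 * ((R ×ˢ R).filter fun x => x.1 < x.2).card := by
    have hu : R.offDiag = ((R ×ˢ R).filter fun x => x.1 < x.2) ∪
        ((R ×ˢ R).filter fun x => x.2 < x.1) := by
      ext x
      simp only [Finset.mem_offDiag, Finset.mem_union, Finset.mem_filter, Finset.mem_product]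
      grind
    have hc : ((R ×ˢ R).filter fun x => x.2 < x.1).card
        = ((R ×ˢ R).filter fun x => x.1 < x.2).card := by
      refine Finset.card_bij' (fun x _ => x.swap) (fun x _ => x.swap) ?_ ?_ ?_ ?_ <;>
        simp +contextual
    rw [hu, Finset.card_union_of_disjoint, hc, two_mul]
    rw [Finset.disjoint_filter]
    intro x _ h
    exact h.asymm
  rw [Finset.offDiag_card, ← Nat.mul_sub_one] at h1
  rw [Nat.choose_two_right, h1]
  simp

lemma ncard_formIdem {s : F} (hs : s ≠ 0) {M R : Finset ι} (hd : Disjoint M R) :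
    (formIdem s M R).ncard = M.card * (1 + R.card)
      + ((if s = -1 then Fintype.card F ^ R.card else 1)
        + (R.card * ((conicPts s \ {(1, 1)}).ncard + if s = -1 then 0 else 1)
          + R.card.choose 2 * (conicPts s \ {(1, 1)}).ncard)) := by
  rw [formIdem_eq hs hd]
  have aniso : ∀ {i : ι} {v : (ι → F) × (ι → F)},
      v.1 i * v.1 i + s * (v.2 i * v.2 i) ≠ 0 → v ∉ isoPart s R :=
    fun hne hv => hne ((isoPart_spec hv).2 _)
  rw [Set.ncard_union_eq _ (Set.toFinite _) (Set.toFinite _),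
    Set.ncard_union_eq _ (Set.toFinite _) (Set.toFinite _),
    Set.ncard_union_eq _ (Set.toFinite _) (Set.toFinite _)]
  · congr 1
    · rw [Set.ncard_image_of_injective, Set.ncard_prod, Set.ncard_coe_finset, ncard_orthIdem]
      rintro ⟨i, Z⟩ ⟨j, W⟩ hij
      simp only [Prod.mk.injEq] at hij
      obtain ⟨h1, rfl⟩ := hij
      by_cases hne : i = j
      · rw [hne]
      · have := congrFun h1 i
        simp [hne] at this
    congr 1
    · unfold isoPart
      split_ifs
      · rw [Set.ncard_image_of_injective, ncard_supported]
        intro v w hvw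
        exact congrArg Prod.fst hvw
      · exact Set.ncard_singleton _
    congr 1
    · rw [Set.InjOn.ncard_image, Set.ncard_prod, Set.ncard_coe_finset, ncard_conicPts]
      rintro ⟨i, u⟩ ⟨-, hu⟩ ⟨j, w⟩ ⟨-, hw⟩ hij
      have h1 := fun r => congrFun (congrArg Prod.fst hij) r
      have h2 := fun r => congrFun (congrArg Prod.snd hij) r
      simp only [onePt] at h1 h2
      by_cases hne : i = j
      · subst hne
        have a := h1 i
        have b := h2 i
        simp only [Pi.single_eq_same] at a b
        rw [Prod.ext a b]
      · have a := h1 i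
        have b := h2 i
        simp only [Pi.single_eq_same, Pi.single_eq_of_ne hne] at a b
        exact absurd (by simp [a, b]) hu.2
    · rw [Set.InjOn.ncard_image, Set.ncard_prod, Set.ncard_coe_finset, card_filter_lt]
      rintro ⟨⟨i, j⟩, u⟩ ⟨hij, hu, hu1⟩ ⟨⟨i', j'⟩, w⟩ ⟨hij', hw, hw1⟩ e
      have h1 := fun r => congrFun (congrArg Prod.fst e) r
      have h2 := fun r => congrFun (congrArg Prod.snd e) r
      have hlt : i < j := by simp at hij; exact hij.2
      have hlt' : i' < j' := by simp at hij'; exact hij'.2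
      have ne0 : ∀ {u : F × F}, u ∈ conicPts s → ¬ (u.1 = 0 ∧ u.2 = 0) := by
        intro u hu h
        exact hu.2 (by simp [h.1, h.2])
      have ne1 : ∀ {u : F × F}, u ∉ ({(1, 1)} : Set (F × F)) → ¬ (1 - u.1 = 0 ∧ 1 - u.2 = 0) := by
        intro u hu h
        exact hu (Prod.ext (sub_eq_zero.1 h.1).symm (sub_eq_zero.1 h.2).symm)
      have nu := ne0 hu
      have nw := ne0 hw
      have nu1 := ne1 hu1
      have nw1 := ne1 hw1
      simp only [twoPt] at h1 h2
      have hi : i = i' ∧ j = j' := by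
        have a1 := h1 i
        have a2 := h2 i
        have b1 := h1 j
        have b2 := h2 j
        have c1 := h1 i'
        have c2 := h2 i'
        clear h1 h2 hij hij' hu hw hu1 hw1 e
        grind
      obtain ⟨rfl, rfl⟩ := hi
      have a := h1 i
      have b := h2 i
      simp only [if_true] at a b
      rw [Prod.ext a b]
  · rw [Set.disjoint_left]
    rintro _ ⟨⟨i, u⟩, ⟨-, hu⟩, rfl⟩ ⟨⟨⟨a, b⟩, w⟩, ⟨hab, hw, hw1⟩, e⟩
    have h1 := fun r => congrFun (congrArg Prod.fst e) r
    have h2 := fun r => congrFun (congrArg Prod.snd e) r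
    have hlt : a < b := by simp at hab; exact hab.2
    have n1 : ¬ (w.1 = 0 ∧ w.2 = 0) := fun h => hw.2 (by simp [h.1, h.2])
    have n2 : ¬ (1 - w.1 = 0 ∧ 1 - w.2 = 0) := fun h =>
      hw1 (Prod.ext (sub_eq_zero.1 h.1).symm (sub_eq_zero.1 h.2).symm)
    simp only [onePt, twoPt] at h1 h2
    have ha : a = i := by
      by_contra hc
      exact n1 ⟨by simpa [hc] using h1 a, by simpa [hc] using h2 a⟩
    have hb : b ≠ i := by rw [← ha]; exact hlt.ne'
    exact n2 ⟨by simpa [hb, hlt.ne'] using h1 b, by simpa [hb, hlt.ne'] using h2 b⟩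
  · rw [Set.disjoint_left]
    rintro v hv (⟨⟨i, u⟩, ⟨-, hu⟩, rfl⟩ | ⟨⟨⟨a, b⟩, w⟩, ⟨hab, hw, hw1⟩, rfl⟩)
    · exact aniso (i := i) (by simpa [onePt] using hu.2) hv
    · exact aniso (i := a) (by simpa [twoPt] using hw.2) hv
  · rw [Set.disjoint_left]
    rintro _ ⟨⟨i, Z⟩, ⟨hi, -⟩, rfl⟩ hv
    have hiR : i ∉ R := Finset.disjoint_left.1 hd hi
    rcases hv with hv | ⟨⟨j, u⟩, ⟨hj, -⟩, e⟩ | ⟨⟨⟨a, b⟩, w⟩, ⟨hab, -⟩, e⟩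
    · simpa using ((isoPart_spec hv).1 i hiR).1
    · have hne : i ≠ j := by rintro rfl; exact hiR hj
      have := congrFun (congrArg Prod.fst e) i
      simp [onePt, hne] at this
    · simp only [Finset.coe_filter, Finset.mem_product, Set.mem_ofPred_eq] at hab
      have h1 : i ≠ a := by rintro rfl; exact hiR hab.1.1
      have h2 : i ≠ b := by rintro rfl; exact hiR hab.1.2
      have := congrFun (congrArg Prod.fst e) i
      simp [twoPt, h1, h2] at this

omit [Fintype F] in
lemma setOf_conicPts_eq [Finite F] (W : Finset F) (hW : ∀ y, y ∈ W ↔ y ≠ 0 ∧ y ≠ 1) :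
    {x : F × F × F | x.1 ≠ 0 ∧ x.2 ∈ conicPts x.1 \ {(1, 1)}} =
      {s : F | s ≠ 0} ×ˢ {((1, 0) : F × F)} ∪ ({s : F | s ≠ 0} ×ˢ {((0, 1) : F × F)} ∪
        (fun u : F × F => (-(u.1 * u.1 - u.1) / (u.2 * u.2 - u.2), u)) '' W.offDiag) := by
  have hW' : ∀ y, y ∈ W → y * y - y ≠ 0 := by
    intro y hy h
    have h2 : y * (y - 1) = 0 := by linear_combination h
    rcases mul_eq_zero.1 h2 with h3 | h3
    · exact ((hW y).1 hy).1 h3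
    · exact ((hW y).1 hy).2 (sub_eq_zero.1 h3)
  ext ⟨s, y, z⟩
  simp only [Set.mem_ofPred_eq, Set.mem_union, Set.mem_prod, Set.mem_singleton_iff,
    Set.mem_image, Finset.mem_coe, Finset.mem_offDiag, conicPts, Set.mem_sdiff, Prod.mk.injEq]
  constructor
  · rintro ⟨hs, ⟨h, hn⟩, h1⟩
    by_cases hz : z ∈ W
    · right; right
      have hzz := hW' z hz
      have hse : s * (z * z - z) = -(y * y - y) := by linear_combination h
      have hy : y ∈ W := by
        rw [hW]
        refine ⟨?_, ?_⟩
        · rintro rfl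
          exact mul_ne_zero hs hzz (by rw [hse]; ring)
        · rintro rfl
          exact mul_ne_zero hs hzz (by rw [hse]; ring)
      refine ⟨(y, z), ⟨hy, hz, ?_⟩, (eq_div_of_mul_eq hzz hse).symm, rfl⟩
      intro (e : y = z)
      subst e
      have h2 : (s + 1) * (y * y - y) = 0 := by linear_combination h
      have h3 := (mul_eq_zero.1 h2).resolve_right hzz
      exact hn (by linear_combination y * y * h3)
    · rw [hW, not_and_or, not_not, not_not] at hz
      have hy : y = 0 ∨ y = 1 := by
        have : y * (y - 1) = 0 := by
          rcases hz with rfl | rfl <;> linear_combination h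
        rcases mul_eq_zero.1 this with h | h
        · exact Or.inl h
        · exact Or.inr (sub_eq_zero.1 h)
      rcases hz with rfl | rfl <;> rcases hy with rfl | rfl <;> simp_all
  · rintro (⟨hs, rfl, rfl⟩ | ⟨hs, rfl, rfl⟩ | ⟨⟨y, z⟩, ⟨hy, hz, hyz⟩, h1, rfl, rfl⟩)
    · simp [hs]
    · simp [hs]
    · simp only at hy hz hyz h1 ⊢
      have hyy := hW' y hy
      have hzz := hW' z hz
      rw [div_eq_iff hzz] at h1
      have hs : s ≠ 0 := by
        rintro rfl
        exact hyy (by linear_combination -h1)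
      refine ⟨hs, ⟨by linear_combination -h1, ?_⟩, fun h => ((hW y).1 hy).2 h.1⟩
      intro hc
      have h2 : y * (z - y) = 0 := by linear_combination (z - 1) * (hc + h1) + h1
      rcases mul_eq_zero.1 h2 with h3 | h3
      · exact ((hW y).1 hy).1 h3
      · exact hyz (sub_eq_zero.1 h3).symm

lemma sum_ncard_conicPts :
    ((∑ s ∈ Finset.univ.erase (0 : F), (conicPts s \ {(1, 1)}).ncard : ℕ) : ℤ) =
      2 * ((Fintype.card F : ℤ) - 1)
        + ((Fintype.card F : ℤ) - 2) * ((Fintype.card F : ℤ) - 3) := by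
  set W : Finset F := (Finset.univ.erase 0).erase 1 with hWdef
  have hW : ∀ y, y ∈ W ↔ y ≠ 0 ∧ y ≠ 1 := by
    intro y; simp [hWdef, and_comm]
  have hq : 1 < Fintype.card F := Fintype.one_lt_card
  have hWc : W.card = Fintype.card F - 2 := by
    rw [hWdef, Finset.card_erase_of_mem (by simp), Finset.card_erase_of_mem (by simp),
      Finset.card_univ]
    omega
  have hne : {s : F | s ≠ 0}.ncard = Fintype.card F - 1 := by
    have : {s : F | s ≠ 0} = (Finset.univ.erase 0 : Finset F) := by ext; simp
    rw [this, Set.ncard_coe_finset, Finset.card_erase_of_mem (by simp), Finset.card_univ]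
  have h1 : ∑ s ∈ Finset.univ.erase (0 : F), (conicPts s \ {(1, 1)}).ncard
      = {x : F × F × F | x.1 ≠ 0 ∧ x.2 ∈ conicPts x.1 \ {(1, 1)}}.ncard := by
    rw [ncard_setOf_prod (fun (s : F) (u : F × F) => s ≠ 0 ∧ u ∈ conicPts s \ {(1, 1)})]
    refine Eq.trans (Finset.sum_congr rfl fun s hs => ?_) (Finset.sum_erase _ (by simp))
    have : s ≠ 0 := by simpa using hs
    simp only [this, ne_eq, not_false_eq_true, true_and]
    rfl
  rw [h1, setOf_conicPts_eq W hW, Set.ncard_union_eq _ (Set.toFinite _) (Set.toFinite _),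
    Set.ncard_union_eq _ (Set.toFinite _) (Set.toFinite _), Set.ncard_prod, Set.ncard_prod,
    Set.ncard_singleton, Set.ncard_singleton, Set.ncard_image_of_injective, Set.ncard_coe_finset,
    Finset.offDiag_card, hne, hWc]
  · obtain ⟨r, hr⟩ : ∃ r, Fintype.card F = r + 2 := ⟨_, (Nat.sub_add_cancel hq).symm⟩
    rw [hr]
    have : r ≤ r * r := Nat.le_mul_self r
    push_cast [Nat.cast_sub this, Nat.add_sub_cancel, show r + 2 - 1 = r + 1 from rfl]
    ring
  · intro u v h
    exact congrArg Prod.snd h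
  · rw [Set.disjoint_left]
    rintro ⟨s, y, z⟩ ⟨-, h⟩ ⟨u, hu, e⟩
    simp only [Finset.coe_offDiag, Set.mem_offDiag, Finset.mem_coe, hW] at hu
    simp only [Set.mem_singleton_iff, Prod.mk.injEq] at h e
    exact hu.1.1 (by rw [e.2]; exact h.1)
  · rw [Set.disjoint_left]
    rintro ⟨s, y, z⟩ ⟨-, h⟩ (⟨-, h'⟩ | ⟨u, hu, e⟩)
    · simp only [Set.mem_singleton_iff, Prod.mk.injEq] at h h'
      exact one_ne_zero (h.1.symm.trans h'.1)
    · simp only [Finset.coe_offDiag, Set.mem_offDiag, Finset.mem_coe, hW] at hu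
      simp only [Set.mem_singleton_iff, Prod.mk.injEq] at h e
      exact hu.1.2 (by rw [e.2]; exact h.1)

/-- The total number of pairs in `formIdem s M R` over all nonzero `s`. -/
lemma sum_ncard_formIdem {M R : Finset ι} (hd : Disjoint M R) :
    ((∑ s ∈ Finset.univ.erase (0 : F), (formIdem s M R).ncard : ℕ) : ℤ) =
      ((Fintype.card F : ℤ) - 1) * (M.card * (1 + R.card))
        + (Fintype.card F : ℤ) ^ R.card + (Fintype.card F - 2) + R.card * (Fintype.card F - 2)
        + ((R.card : ℤ) + (R.card.choose 2 : ℕ)) * (2 * ((Fintype.card F : ℤ) - 1)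
          + ((Fintype.card F : ℤ) - 2) * ((Fintype.card F : ℤ) - 3)) := by
  have hq : 1 < Fintype.card F := Fintype.one_lt_card
  have hcard : (Finset.univ.erase (0 : F)).card = Fintype.card F - 1 := by
    rw [Finset.card_erase_of_mem (by simp), Finset.card_univ]
  have hm1 : (-1 : F) ∈ Finset.univ.erase (0 : F) := by simp
  have hcard2 : ((Finset.univ.erase (0 : F)).erase (-1)).card = Fintype.card F - 2 := by
    rw [Finset.card_erase_of_mem hm1, hcard]; omega
  have hite : ∀ a b : ℕ, ∑ s ∈ Finset.univ.erase (0 : F), (if s = -1 then a else b)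
      = a + (Fintype.card F - 2) * b := by
    intro a b
    rw [← Finset.add_sum_erase _ _ hm1, if_pos rfl, Finset.sum_congr rfl (g := fun _ => b),
      Finset.sum_const, hcard2, smul_eq_mul]
    intro s hs
    rw [if_neg (Finset.ne_of_mem_erase hs)]
  rw [← sum_ncard_conicPts, Finset.sum_congr rfl fun s hs =>
    ncard_formIdem (Finset.ne_of_mem_erase hs) hd]
  simp only [Finset.sum_add_distrib, ← Finset.mul_sum, hite, Finset.sum_const, hcard, smul_eq_mul]
  push_cast [Nat.cast_sub hq.le, Nat.cast_sub (show 2 ≤ Fintype.card F from hq)]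
  ring

omit [LinearOrder ι] [Field F] in
lemma sum_three_coords [DecidableEq ι] {o k l : ι} (hok : o ≠ k) (hol : o ≠ l) (hkl : k ≠ l)
    (f : F → F → F → ℕ) :
    ∑ v : ι → F, f (v o) (v k) (v l)
      = Fintype.card F ^ (Fintype.card ι - 3) * ∑ a, ∑ b, ∑ c, f a b c := by
  rw [← Finset.sum_fiberwise Finset.univ (fun v : ι → F => (v o, v k, v l))]
  simp only [Fintype.sum_prod_type, Finset.mul_sum]
  refine Finset.sum_congr rfl fun a _ => Finset.sum_congr rfl fun b _ =>
    Finset.sum_congr rfl fun c _ => ?_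
  rw [Finset.sum_congr rfl (g := fun _ => f a b c), Finset.sum_const, smul_eq_mul]
  · congr 1
    have h3 : ({o, k, l} : Finset ι).card = 3 := by
      rw [Finset.card_eq_three]; exact ⟨o, k, l, hok, hol, hkl, rfl⟩
    rw [← h3, ← Finset.card_compl,
      ← ncard_prescribed {o, k, l} (fun j => if j = o then a else if j = k then b else c),
      ← Set.ncard_coe_finset]
    congr 1
    ext v
    simp [hok.symm, hol.symm, hkl.symm]
  · intro v hv
    simp only [Finset.mem_filter, Finset.mem_univ, true_and, Prod.mk.injEq] at hv
    rw [hv.1, hv.2.1, hv.2.2]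

/-- The solutions of the first alternative of `RowCond`. -/
def smallSet (a b : F) (M R : Finset ι) : Set ((ι → F) × (ι → F)) :=
  {v | (∀ j, j ∉ M ∪ R → v.1 j = 0) ∧ (∀ j, j ∉ R → v.2 j = 0) ∧
    ∀ i j, a * (v.1 i * v.1 j - if i = j then v.1 i else 0)
      + b * (v.2 i * v.2 j - if i = j then v.2 i else 0) = 0}

omit [DecidableEq F] in
lemma ncard_smallSet_zero_zero (M R : Finset ι) (hd : Disjoint M R) :
    (smallSet (0 : F) 0 M R).ncard
      = Fintype.card F ^ (M.card + R.card) * Fintype.card F ^ R.card := by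
  have : smallSet (0 : F) 0 M R =
      {v : ι → F | ∀ j, j ∉ M ∪ R → v j = 0} ×ˢ {v : ι → F | ∀ j, j ∉ R → v j = 0} := by
    ext v; simp [smallSet]
  rw [this, Set.ncard_prod, ncard_supported, ncard_supported, Finset.card_union_of_disjoint hd]

omit [DecidableEq F] in
lemma ncard_smallSet_right_zero (M R : Finset ι) (hd : Disjoint M R) {a : F} (ha : a ≠ 0) :
    (smallSet a 0 M R).ncard = (1 + (M.card + R.card)) * Fintype.card F ^ R.card := by
  have : smallSet a 0 M R = orthIdem F (M ∪ R) ×ˢ {v : ι → F | ∀ j, j ∉ R → v j = 0} := by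
    ext v
    simp only [smallSet, orthIdem, zero_mul, add_zero, mul_eq_zero, ha, false_or, sub_eq_zero,
      Set.mem_ofPred_eq, Set.mem_prod]
    tauto
  rw [this, Set.ncard_prod, ncard_supported, ncard_orthIdem, Finset.card_union_of_disjoint hd]

omit [DecidableEq F] in
lemma ncard_smallSet_left_zero (M R : Finset ι) (hd : Disjoint M R) {b : F} (hb : b ≠ 0) :
    (smallSet 0 b M R).ncard = Fintype.card F ^ (M.card + R.card) * (1 + R.card) := by
  have : smallSet 0 b M R = {v : ι → F | ∀ j, j ∉ M ∪ R → v j = 0} ×ˢ orthIdem F R := by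
    ext v
    simp only [smallSet, orthIdem, zero_mul, zero_add, mul_eq_zero, hb, false_or, sub_eq_zero,
      Set.mem_ofPred_eq, Set.mem_prod]
  rw [this, Set.ncard_prod, ncard_supported, ncard_orthIdem, Finset.card_union_of_disjoint hd]

omit [Fintype ι] [Fintype F] [DecidableEq F] in
lemma smallSet_eq_formIdem (M R : Finset ι) {a b : F} (ha : a ≠ 0) :
    smallSet a b M R = formIdem (b / a) M R := by
  ext v
  simp only [smallSet, formIdem, Set.mem_ofPred_eq]
  refine and_congr_right fun _ => and_congr_right fun _ => forall_congr' fun i =>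
    forall_congr' fun j => ?_
  constructor
  · intro h
    apply mul_left_cancel₀ ha
    rw [mul_add, ← mul_assoc, mul_div_cancel₀ b ha, h, mul_zero]
  · intro h
    rw [← mul_div_cancel₀ b ha, mul_assoc, ← mul_add, h, mul_zero]

/-- The sum of the number of solutions of the first alternative of `RowCond`. -/
lemma sum_ncard_smallSet {M R : Finset ι} (hd : Disjoint M R) :
    ((∑ a : F, ∑ b : F, (smallSet a b M R).ncard : ℕ) : ℤ) =
      (Fintype.card F : ℤ) ^ (M.card + 2 * R.card)
      + ((Fintype.card F : ℤ) - 1) * (1 + R.card) * (Fintype.card F : ℤ) ^ (M.card + R.card)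
      + ((Fintype.card F : ℤ) - 1) * (1 + M.card + R.card) * (Fintype.card F : ℤ) ^ R.card
      + ((Fintype.card F : ℤ) - 1) *
        (∑ s ∈ Finset.univ.erase (0 : F), (formIdem s M R).ncard : ℕ) := by
  have hq : 1 < Fintype.card F := Fintype.one_lt_card
  have hcard : (Finset.univ.erase (0 : F)).card = Fintype.card F - 1 := by
    rw [Finset.card_erase_of_mem (by simp), Finset.card_univ]
  have h0 : ∑ b : F, (smallSet 0 b M R).ncard =
      Fintype.card F ^ (M.card + R.card) * Fintype.card F ^ R.card
      + (Fintype.card F - 1) * (Fintype.card F ^ (M.card + R.card) * (1 + R.card)) := by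
    rw [← Finset.add_sum_erase _ _ (Finset.mem_univ (0 : F)), ncard_smallSet_zero_zero M R hd,
      Finset.sum_congr rfl fun b hb =>
        ncard_smallSet_left_zero M R hd (Finset.ne_of_mem_erase hb),
      Finset.sum_const, hcard, smul_eq_mul]
  have h1 : ∀ a ∈ Finset.univ.erase (0 : F), ∑ b : F, (smallSet a b M R).ncard =
      (1 + (M.card + R.card)) * Fintype.card F ^ R.card
        + ∑ s ∈ Finset.univ.erase (0 : F), (formIdem s M R).ncard := by
    intro a ha
    have ha := Finset.ne_of_mem_erase ha
    rw [← Finset.add_sum_erase _ _ (Finset.mem_univ (0 : F)), ncard_smallSet_right_zero M R hd ha]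
    congr 1
    refine Finset.sum_nbij' (fun b => b / a) (fun s => s * a) ?_ ?_ ?_ ?_ ?_
    · intro b hb; simp_all
    · intro s hs; simp_all
    · intro b _; exact div_mul_cancel₀ b ha
    · intro s _; exact mul_div_cancel_right₀ s ha
    · intro b _; rw [smallSet_eq_formIdem M R ha]
  rw [← Finset.add_sum_erase _ _ (Finset.mem_univ (0 : F)), h0, Finset.sum_congr rfl h1,
    Finset.sum_const, hcard, smul_eq_mul]
  push_cast [Nat.cast_sub hq.le]
  ring

/-- The pairs of rows satisfying `RowCond` with prescribed supports. -/
def rowSet (l : ι) (a b : F) (M R : Finset ι) : Set ((ι → F) × (ι → F)) :=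
  {v | (∀ j, j ∉ insert l (M ∪ R) → v.1 j = 0) ∧ (∀ j, j ∉ R → v.2 j = 0) ∧
    RowCond l a b v.1 v.2}

lemma ncard_rowSet {l : ι} {M R : Finset ι} (hd : Disjoint M R) (hl : l ∉ M ∪ R) (a b : F) :
    (rowSet l a b M R).ncard = (smallSet a b M R).ncard
      + if a = 0 then (Fintype.card F - 1) * Fintype.card F ^ (M.card + R.card) * (1 + R.card)
        else 0 := by
  have hsplit : rowSet l a b M R = smallSet a b M R ∪
      {v | a = 0 ∧ v ∈ ({Y : ι → F | (∀ j, j ∉ insert l (M ∪ R) → Y j = 0)} \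
        {Y : ι → F | (∀ j, j ∉ M ∪ R → Y j = 0)}) ×ˢ orthIdem F R} := by
    have hYl : ∀ Y : ι → F, (∀ j, j ∉ insert l (M ∪ R) → Y j = 0) →
        ((∀ j, j ∉ M ∪ R → Y j = 0) ↔ Y l = 0) := by
      intro Y hY
      refine ⟨fun h => h l hl, fun h j hj => ?_⟩
      by_cases hjl : j = l
      · rw [hjl, h]
      · exact hY j (by simp only [Finset.mem_insert]; tauto)
    have hsub : ∀ Y : ι → F, (∀ j, j ∉ M ∪ R → Y j = 0) →
        (∀ j, j ∉ insert l (M ∪ R) → Y j = 0) :=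
      fun Y hY j hj => hY j fun h => hj (Finset.mem_insert_of_mem h)
    ext ⟨Y, Z⟩
    simp only [rowSet, smallSet, orthIdem, RowCond, Set.mem_union, Set.mem_ofPred_eq,
      Set.mem_prod, Set.mem_sdiff]
    have h1 := hYl Y
    have h2 := hsub Y
    tauto
  have hB : ({Y : ι → F | (∀ j, j ∉ insert l (M ∪ R) → Y j = 0)} \
        {Y : ι → F | (∀ j, j ∉ M ∪ R → Y j = 0)}).ncard
      = (Fintype.card F - 1) * Fintype.card F ^ (M.card + R.card) := by
    rw [Set.ncard_sdiff, ncard_supported, ncard_supported, Finset.card_insert_of_notMem hl,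
      Finset.card_union_of_disjoint hd, Nat.sub_mul, one_mul, pow_succ']
    exact fun Y hY j hj => hY j fun h => hj (Finset.mem_insert_of_mem h)
  rw [hsplit, Set.ncard_union_eq _ (Set.toFinite _) (Set.toFinite _)]
  · congr 1
    split_ifs with ha
    · simp only [ha, true_and]
      rw [← ncard_orthIdem (F := F), ← hB, ← Set.ncard_prod]
      rfl
    · simp [ha]
  · rw [Set.disjoint_left]
    rintro v hv ⟨-, ⟨-, hY⟩, -⟩
    exact hY hv.1

lemma sum_ncard_rowSet {l : ι} {M R : Finset ι} (hd : Disjoint M R) (hl : l ∉ M ∪ R) :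
    ((∑ a : F, ∑ b : F, (rowSet l a b M R).ncard : ℕ) : ℤ) =
      (∑ a : F, ∑ b : F, (smallSet a b M R).ncard : ℕ)
      + ((Fintype.card F : ℤ) - 1) * (1 + R.card) * (Fintype.card F : ℤ) ^ (M.card + R.card + 1) := by
  have hq : 1 < Fintype.card F := Fintype.one_lt_card
  simp only [ncard_rowSet hd hl, Finset.sum_add_distrib, Finset.sum_const, Finset.card_univ,
    smul_eq_mul, mul_ite, mul_zero, Finset.sum_ite_eq', Finset.mem_univ, if_true]
  push_cast [Nat.cast_sub hq.le]
  ring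

end Conic

lemma gMat_diagExp {m p : ℕ} [Fact p.Prime] {o k l : Fin m} (ho : (o : ℕ) = 0) (hok : o < k)
    (hkl : k < l) :
    gMat p (diagExp o k l) = p ^ (m - 3) * ∑ a : ZMod p, ∑ b : ZMod p,
      (rowSet l a b (Finset.Ioo k l) (Finset.Ioi l)).ncard := by
  classical
  rw [gMat_diagExp_eq_ncard hok hkl, ncard_setOf_prod (fun (X : Fin m → ZMod p)
    (v : (Fin m → ZMod p) × (Fin m → ZMod p)) => Triangular o k l X v.1 v.2 ∧
      RowCond l (X k) (X l) v.1 v.2)]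
  have key : ∀ X : Fin m → ZMod p, {v : (Fin m → ZMod p) × (Fin m → ZMod p) |
      Triangular o k l X v.1 v.2 ∧ RowCond l (X k) (X l) v.1 v.2}.ncard =
      if X o = 0 then (rowSet l (X k) (X l) (Finset.Ioo k l) (Finset.Ioi l)).ncard else 0 := by
    intro X
    split_ifs with hX
    · congr 1
      ext v
      have hmem : ∀ j, j ∉ insert l (Finset.Ioo k l ∪ Finset.Ioi l) ↔ j ≤ k := by
        intro j
        simp only [Finset.mem_insert, Finset.mem_union, Finset.mem_Ioo, Finset.mem_Ioi]
        omega
      have hmem' : ∀ j, j ∉ Finset.Ioi l ↔ j ≤ l := by simp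
      simp only [rowSet, Set.mem_ofPred_eq, hmem, hmem']
      constructor
      · rintro ⟨hT, h⟩
        exact ⟨hT.mid, hT.right, h⟩
      · rintro ⟨h1, h2, h⟩
        refine ⟨⟨fun j hj => ?_, h1, h2⟩, h⟩
        rw [show j = o from Fin.ext (by have := Fin.le_def.1 hj; omega), hX]
    · rw [Set.ncard_eq_zero]
      ext v
      simp only [Set.mem_ofPred_eq, Set.mem_empty_iff_false, iff_false]
      rintro ⟨hT, -⟩
      exact hX (hT.left o le_rfl)
  rw [Finset.sum_congr rfl fun X _ => key X, sum_three_coords hok.ne (hok.trans hkl).ne hkl.ne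
    (fun x a b => if x = 0 then (rowSet l a b (Finset.Ioo k l) (Finset.Ioi l)).ncard else 0),
    ZMod.card, Fintype.card_fin]
  congr 1
  rw [Finset.sum_eq_single_of_mem 0 (Finset.mem_univ _)]
  · simp
  · intro x _ hx
    simp [hx]

end IrrSubring

/-- For a prime `p`, `n ≥ 4` and `1 ≤ k < ℓ ≤ n-2`, let `α` be the composition of length
`n-1` with the value `2` in positions `1`, `k+1` and `ℓ+1`, and all other parts `1`.  Then
`g_α(p) = p^{3n-k-ℓ-9} + (n-ℓ-1)(p-1)(p+1)p^{2n-k-7} + (n-k-1)(p-1)p^{2n-ℓ-6}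
  - (n-ℓ-1)p^{n-4}(p-1) + (n-k-2)(n-ℓ-1)(p-1)²p^{n-4}
  + ((n-ℓ-2) + C(n-ℓ-2, 2))(p-1)(p-2)(p-3)p^{n-4}`. -/
theorem gMat_two_two_two (p : ℕ) (hp : p.Prime) (n k ℓ : ℕ) (hn : 4 ≤ n)
    (hk1 : 1 ≤ k) (hkl : k < ℓ) (hln : ℓ ≤ n - 2) :
    (gMat p (fun i : Fin (n - 1) =>
        if (i : ℕ) = 0 ∨ (i : ℕ) = k ∨ (i : ℕ) = ℓ then 2 else 1) : ℤ) =
      (p : ℤ) ^ (3 * n - k - ℓ - 9)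
        + ((n : ℤ) - ℓ - 1) * ((p : ℤ) - 1) * ((p : ℤ) + 1) * (p : ℤ) ^ (2 * n - k - 7)
        + ((n : ℤ) - k - 1) * ((p : ℤ) - 1) * (p : ℤ) ^ (2 * n - ℓ - 6)
        - ((n : ℤ) - ℓ - 1) * (p : ℤ) ^ (n - 4) * ((p : ℤ) - 1)
        + ((n : ℤ) - k - 2) * ((n : ℤ) - ℓ - 1) * ((p : ℤ) - 1) ^ 2 * (p : ℤ) ^ (n - 4)
        + (((n : ℤ) - ℓ - 2) + (Nat.choose (n - ℓ - 2) 2 : ℤ)) * ((p : ℤ) - 1)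
            * ((p : ℤ) - 2) * ((p : ℤ) - 3) * (p : ℤ) ^ (n - 4) := by
  have : Fact p.Prime := ⟨hp⟩
  obtain ⟨k', rfl⟩ : ∃ k', k = k' + 1 := ⟨k - 1, by omega⟩
  obtain ⟨a, rfl⟩ : ∃ a, ℓ = k' + 1 + 1 + a := ⟨ℓ - (k' + 1 + 1), by omega⟩
  obtain ⟨b, rfl⟩ : ∃ b, n = k' + a + b + 3 + 1 := ⟨n - (k' + a + 4), by omega⟩
  let o : Fin (k' + a + b + 3) := ⟨0, by omega⟩
  let k : Fin (k' + a + b + 3) := ⟨k' + 1, by omega⟩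
  let l : Fin (k' + a + b + 3) := ⟨k' + 1 + 1 + a, by omega⟩
  have hok : o < k := Fin.mk_lt_mk.2 (by omega)
  have hkl : k < l := Fin.mk_lt_mk.2 (by omega)
  have hα : (fun i : Fin (k' + a + b + 3 + 1 - 1) =>
      if (i : ℕ) = 0 ∨ (i : ℕ) = k' + 1 ∨ (i : ℕ) = k' + 1 + 1 + a then 2 else 1)
      = IrrSubring.diagExp o k l := by
    funext i
    simp only [IrrSubring.diagExp, Fin.ext_iff, o, k, l]
  have hM : (Finset.Ioo k l).card = a := by rw [Fin.card_Ioo]; simp only [k, l]; omega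
  have hR : (Finset.Ioi l).card = b := by rw [Fin.card_Ioi]; simp only [l]; omega
  have hd : Disjoint (Finset.Ioo k l) (Finset.Ioi l) := by
    rw [Finset.disjoint_left]
    intro x hx hx'
    exact lt_asymm (Finset.mem_Ioo.1 hx).2 (Finset.mem_Ioi.1 hx')
  have hl : l ∉ Finset.Ioo k l ∪ Finset.Ioi l := by simp
  have hC : (b : ℤ) * b = 2 * (b.choose 2 : ℕ) + b := by
    rcases b with _ | b
    · simp
    · rw [Nat.choose_two_right]
      have h2 : 2 ∣ (b + 1) * (b + 1 - 1) := (Nat.even_mul_pred_self (b + 1)).two_dvd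
      have h3 := Nat.mul_div_cancel' h2
      have h4 : ((2 * ((b + 1) * (b + 1 - 1) / 2) : ℕ) : ℤ) = ((b + 1) * (b + 1 - 1) : ℕ) := by
        rw [h3]
      push_cast [Nat.add_sub_cancel] at h4 ⊢
      linarith
  rw [hα]
  erw [IrrSubring.gMat_diagExp rfl hok hkl]
  rw [Nat.cast_mul, IrrSubring.sum_ncard_rowSet hd hl, IrrSubring.sum_ncard_smallSet hd,
    IrrSubring.sum_ncard_formIdem hd, hM, hR, ZMod.card]
  rw [show 3 * (k' + a + b + 3 + 1) - (k' + 1) - (k' + 1 + 1 + a) - 9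
      = (k' + a + b) + (a + 2 * b) by omega,
    show 2 * (k' + a + b + 3 + 1) - (k' + 1) - 7 = (k' + a + b) + (a + b) by omega,
    show 2 * (k' + a + b + 3 + 1) - (k' + 1 + 1 + a) - 6 = (k' + a + b) + b by omega,
    show k' + a + b + 3 + 1 - 4 = k' + a + b by omega,
    show k' + a + b + 3 - 3 = k' + a + b by omega,
    show k' + a + b + 3 + 1 - (k' + 1 + 1 + a) - 2 = b by omega]
  generalize hc : b.choose 2 = c at *
  push_cast
  rw [pow_add _ (k' + a + b) (a + 2 * b), pow_add _ (k' + a + b) (a + b),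
    pow_add _ (k' + a + b) b, pow_succ]
  generalize (p : ℤ) ^ (k' + a + b) = P
  generalize (p : ℤ) ^ (a + 2 * b) = Q1
  generalize (p : ℤ) ^ (a + b) = Q2
  generalize (p : ℤ) ^ b = Q3
  linear_combination (-P * ((p : ℤ) - 1) ^ 2) * hC
end

section
/- Let $p$ be a prime and $n\ge 4$. For $1\le k<\ell\le n-2$ let $\alpha_{k,\ell}$ be the composition of length $n-1$ with the value $2$ in positions $1$, $k+1$ and $\ell+1$, and all other parts $1$. Then $\sum_{1\le k<\ell\le n-2} g_{\alpha_{k,\ell}}(p) = \frac{p^{n-4}}{24(p-1)^2(p+1)}\Big(12(n-2)(n-3)p^{n+1} + 24p^{n} - 24(n-1)(n-3)p^{n-1} - 24p^{n-2} + 12n(n-3)p^{n-3} + 24p^{2n-5} + (n-1)(n-2)(n-3)(n-4)p^{6} - 4(n-1)(n-2)(n-3)(n-5)p^{5} + (n-1)(n-2)(n-3)(7n-44)p^{4} - 4(n-1)(n-2)(n^2-11n+27)p^{3} - (n-3)(5n^3-43n^2+82n-56)p^{2} + 4(n-3)(2n^3-19n^2+46n-26)p - (n-3)(n-4)(n-5)(3n-2)\Big)$,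 as an identity of rational numbers. -/
section Characterization

variable {m : ℕ}

/-- The diagonal with the value `2` in the positions `o`, `k`, `l` and `1` elsewhere. -/
def twoAt (o k l : Fin m) (i : Fin m) : ℕ := if i = o ∨ i = k ∨ i = l then 2 else 1

/-- The matrix with diagonal `(p ^ twoAt o k l, 1)`, last column `1`, and rows `o`, `k`, `l`
given above the diagonal by `p • X`, `p • Y`, `p • Z`. -/
def threeRowMatrix (p : ℤ) (o k l : Fin m) (X Y Z : Fin m → ℤ) :
    Matrix (Fin (m + 1)) (Fin (m + 1)) ℤ :=
  fun i j => Fin.lastCases (motive := fun _ => ℤ) 1 (fun j' =>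
    Fin.lastCases (motive := fun _ => ℤ) 0 (fun i' =>
      (if i' = j' then p ^ twoAt o k l i' else 0) + (if i' = o then p * X j' else 0)
        + (if i' = k then p * Y j' else 0) + (if i' = l then p * Z j' else 0)) i) j

variable {p : ℤ} {o k l : Fin m} {X Y Z : Fin m → ℤ}

lemma threeRowMatrix_last_right (i : Fin (m + 1)) :
    threeRowMatrix p o k l X Y Z i (Fin.last m) = 1 := by
  simp [threeRowMatrix]

lemma threeRowMatrix_last_castSucc (j : Fin m) :
    threeRowMatrix p o k l X Y Z (Fin.last m) j.castSucc = 0 := by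
  simp [threeRowMatrix]

lemma threeRowMatrix_castSucc (i j : Fin m) :
    threeRowMatrix p o k l X Y Z i.castSucc j.castSucc =
      (if i = j then p ^ twoAt o k l i else 0) + (if i = o then p * X j else 0)
        + (if i = k then p * Y j else 0) + (if i = l then p * Z j else 0) := by
  simp [threeRowMatrix]

lemma threeRowMatrix_mulVec_last (x : Fin (m + 1) → ℤ) :
    (threeRowMatrix p o k l X Y Z).mulVec x (Fin.last m) = x (Fin.last m) := by
  simp [Matrix.mulVec, dotProduct, Fin.sum_univ_castSucc, threeRowMatrix_last_right,
    threeRowMatrix_last_castSucc]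

lemma threeRowMatrix_mulVec_castSucc (x : Fin (m + 1) → ℤ) (i : Fin m) :
    (threeRowMatrix p o k l X Y Z).mulVec x i.castSucc =
      p ^ twoAt o k l i * x i.castSucc
        + (if i = o then p * ∑ j, X j * x j.castSucc else 0)
        + (if i = k then p * ∑ j, Y j * x j.castSucc else 0)
        + (if i = l then p * ∑ j, Z j * x j.castSucc else 0) + x (Fin.last m) := by
  simp only [Matrix.mulVec, dotProduct, Fin.sum_univ_castSucc, threeRowMatrix_last_right,
    threeRowMatrix_castSucc, add_mul, Finset.sum_add_distrib, one_mul]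
  congr 1
  congr 1
  · congr 1
    · congr 1
      · simp
      · split_ifs <;> simp [Finset.mul_sum, mul_assoc]
    · split_ifs <;> simp [Finset.mul_sum, mul_assoc]
  · split_ifs <;> simp [Finset.mul_sum, mul_assoc]

/-- Back substitution: a vector whose entries outside the rows `o`, `k`, `l` are `p • u` lies in
the span of the columns exactly when the remaining three equations are solvable. -/
lemma exists_threeRowMatrix_mulVec_eq_iff (hp : p ≠ 0) (hok : o < k) (hkl : k < l)
    (hX : ∀ j, j ≤ o → X j = 0) (hY : ∀ j, j ≤ k → Y j = 0) (hZ : ∀ j, j ≤ l → Z j = 0)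
    {w : Fin (m + 1) → ℤ} {u : Fin m → ℤ} (hw : w (Fin.last m) = 0)
    (huo : u o = 0) (huk : u k = 0) (hul : u l = 0)
    (hwu : ∀ j, j ≠ o → j ≠ k → j ≠ l → w j.castSucc = p * u j) :
    (∃ x, (threeRowMatrix p o k l X Y Z).mulVec x = w) ↔
      ∃ a b c : ℤ, w l.castSucc = p ^ 2 * c + p * ∑ j, Z j * u j ∧
        w k.castSucc = p ^ 2 * b + p * (Y l * c + ∑ j, Y j * u j) ∧
        w o.castSucc = p ^ 2 * a + p * (X k * b + X l * c + ∑ j, X j * u j) := by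
  have hol := hok.trans hkl
  have sum_eq (V x : Fin m → ℤ) (hx : ∀ j, j ≠ o → j ≠ k → j ≠ l → x j = u j) :
      ∑ j, V j * x j = V o * x o + V k * x k + V l * x l + ∑ j, V j * u j := by
    have h : ∀ j, V j * x j = (if j = o then V o * x o else 0) + (if j = k then V k * x k else 0)
        + (if j = l then V l * x l else 0) + V j * u j := by
      intro j
      by_cases h1 : j = o
      · subst h1; simp [huo, hok.ne, hol.ne]
      by_cases h2 : j = k
      · subst h2; simp [huk, hok.ne', hkl.ne]
      by_cases h3 : j = l
      · subst h3; simp [hul, hol.ne', hkl.ne']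
      simp [h1, h2, h3, hx j h1 h2 h3]
    rw [Finset.sum_congr rfl fun j _ => h j]
    simp [Finset.sum_add_distrib]
  have t1 : twoAt o k l o = 2 := by simp [twoAt]
  have t2 : twoAt o k l k = 2 := by simp [twoAt]
  have t3 : twoAt o k l l = 2 := by simp [twoAt]
  constructor
  · rintro ⟨x, rfl⟩
    rw [threeRowMatrix_mulVec_last] at hw
    have hx : ∀ j, j ≠ o → j ≠ k → j ≠ l → x j.castSucc = u j := by
      intro j h1 h2 h3
      have := hwu j h1 h2 h3
      rw [threeRowMatrix_mulVec_castSucc] at this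
      simpa [h1, h2, h3, hw, twoAt, hp] using this
    refine ⟨x o.castSucc, x k.castSucc, x l.castSucc, ?_, ?_, ?_⟩
    · simp [threeRowMatrix_mulVec_castSucc, hw, sum_eq Z _ hx, hZ o hol.le, hZ k hkl.le,
        hZ l le_rfl, hol.ne', hkl.ne', t3]
    · simp [threeRowMatrix_mulVec_castSucc, hw, sum_eq Y _ hx, hY o hok.le, hY k le_rfl,
        hok.ne', hkl.ne, t2]
    · simp [threeRowMatrix_mulVec_castSucc, hw, sum_eq X _ hx, hX o le_rfl,
        hok.ne, hol.ne, t1]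
  · rintro ⟨a, b, c, hc, hb, ha⟩
    let x' : Fin m → ℤ := fun j =>
      if j = o then a else if j = k then b else if j = l then c else u j
    have hx : ∀ j, j ≠ o → j ≠ k → j ≠ l → x' j = u j := by
      intro j h1 h2 h3; simp [x', h1, h2, h3]
    have xo : x' o = a := by simp [x']
    have xk : x' k = b := by simp [x', hok.ne']
    have xl : x' l = c := by simp [x', hol.ne', hkl.ne']
    refine ⟨Fin.snoc (α := fun _ => ℤ) x' 0, funext fun i => ?_⟩
    refine Fin.lastCases ?_ (fun i => ?_) i
    · simp [threeRowMatrix_mulVec_last, hw]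
    · rw [threeRowMatrix_mulVec_castSucc]
      simp only [Fin.snoc_castSucc, Fin.snoc_last, sum_eq _ _ hx, xo, xk, xl]
      by_cases h1 : i = o
      · subst h1; simp [ha, hok.ne, hol.ne, t1, xo, hX _ le_rfl]
      by_cases h2 : i = k
      · subst h2; simp [hb, hok.ne', hkl.ne, t2, xk, hY o hok.le, hY _ le_rfl]
      by_cases h3 : i = l
      · subst h3; simp [hc, hol.ne', hkl.ne', t3, xl, hZ o hol.le, hZ k hkl.le, hZ _ le_rfl]
      simp [h1, h2, h3, hwu i h1 h2 h3, hx i h1 h2 h3, twoAt]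

lemma twoAt_ne_zero (i : Fin m) : twoAt o k l i ≠ 0 := by
  unfold twoAt; split_ifs <;> simp

lemma dvd_threeRowMatrix (i j : Fin m) :
    p ∣ threeRowMatrix p o k l X Y Z i.castSucc j.castSucc := by
  rw [threeRowMatrix_castSucc]
  refine dvd_add (dvd_add (dvd_add ?_ ?_) ?_) ?_ <;> split_ifs <;> simp [twoAt_ne_zero]

/-- The multiplicative defect `V i * V j - δ i j * V i` of a family `V`, whose vanishing says that
`V` is a family of orthogonal idempotents. -/
def defect {R ι : Type*} [CommRing R] [DecidableEq ι] (V : ι → R) (i j : ι) : R :=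
  V i * V j - if i = j then V i else 0

/-- The product of two columns in generic positions lies in the span of the columns exactly when
two congruences hold. -/
lemma generic_column_mul_iff (hp : p ≠ 0) (hok : o < k) (hkl : k < l)
    (hX : ∀ j, j ≤ o → X j = 0) (hY : ∀ j, j ≤ k → Y j = 0) (hZ : ∀ j, j ≤ l → Z j = 0)
    (hXY : X k * Y l = 0) {i j : Fin m} (hio : i ≠ o) (hik : i ≠ k) (hil : i ≠ l)
    (hjo : j ≠ o) (hjk : j ≠ k) (hjl : j ≠ l) :
    (∃ x, (threeRowMatrix p o k l X Y Z).mulVec x = fun r =>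
      threeRowMatrix p o k l X Y Z r i.castSucc * threeRowMatrix p o k l X Y Z r j.castSucc) ↔
      p ∣ Y l * defect Z i j ∧ p ∣ X l * defect Z i j + X k * defect Y i j := by
  have hol := hok.trans hkl
  have key (V : Fin m → ℤ) : ∑ r, V r * (if i = j then Pi.single i p else 0 : Fin m → ℤ) r
      = (if i = j then V i else 0) * p := by
    split_ifs <;> simp [Pi.single_apply]
  rw [exists_threeRowMatrix_mulVec_eq_iff hp hok hkl hX hY hZ
    (u := if i = j then Pi.single i p else 0)]
  · simp only [key, threeRowMatrix_castSucc, hio.symm, hik.symm, hil.symm, hjo.symm, hjk.symm,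
      hjl.symm, hok.ne, hok.ne', hkl.ne, hkl.ne', hol.ne, hol.ne', if_true, if_false, zero_add,
      add_zero, defect]
    generalize (if i = j then Z i else 0) = dz
    generalize (if i = j then Y i else 0) = dy
    generalize (if i = j then X i else 0) = dx
    have hp2 : p ^ 2 ≠ 0 := pow_ne_zero _ hp
    constructor
    · rintro ⟨a, b, c, hc, hb, ha⟩
      have hc' : c = Z i * Z j - dz := mul_left_cancel₀ hp2 (by linear_combination -hc)
      subst hc'
      have hb' : Y l * (Z i * Z j - dz) = p * (Y i * Y j - dy - b) :=
        mul_left_cancel₀ hp (by linear_combination -hb)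
      have h0 : X k * (Y i * Y j - dy - b) = 0 :=
        mul_left_cancel₀ hp (by linear_combination (Z i * Z j - dz) * hXY - X k * hb')
      refine ⟨⟨_, hb'⟩, X i * X j - dx - a, mul_left_cancel₀ hp ?_⟩
      linear_combination -ha + p * h0
    · rintro ⟨⟨e, he⟩, f, hf⟩
      have h0 : X k * e = 0 :=
        mul_left_cancel₀ hp (by linear_combination (Z i * Z j - dz) * hXY - X k * he)
      refine ⟨X i * X j - dx - f, Y i * Y j - dy - e, Z i * Z j - dz, ?_, ?_, ?_⟩
      · ring
      · linear_combination -p * he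
      · linear_combination -p * hf + p * h0
  · simp [threeRowMatrix_last_castSucc]
  · split_ifs <;> simp [hio.symm]
  · split_ifs <;> simp [hik.symm]
  · split_ifs <;> simp [hil.symm]
  · intro r h1 h2 h3
    simp only [threeRowMatrix_castSucc, h1, h2, h3, if_false, add_zero, twoAt, or_self, pow_one]
    by_cases hij : i = j
    · subst hij
      by_cases hr : r = i <;> simp [hr]
    · by_cases hr : r = i
      · subst hr; simp [hij]
      · simp [hr, hij]

/-- Products with one of the columns `o`, `k`, `l` lie in the span of the columns. -/
lemma special_column_mul (hp : p ≠ 0) (hok : o < k) (hkl : k < l)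
    (hX : ∀ j, j ≤ o → X j = 0) (hY : ∀ j, j ≤ k → Y j = 0) (hZ : ∀ j, j ≤ l → Z j = 0)
    (hXY : X k * Y l = 0) {i : Fin m} (hi : i = o ∨ i = k ∨ i = l) (j : Fin m) :
    ∃ x, (threeRowMatrix p o k l X Y Z).mulVec x = fun r =>
      threeRowMatrix p o k l X Y Z r i.castSucc * threeRowMatrix p o k l X Y Z r j.castSucc := by
  have hol := hok.trans hkl
  have t1 : twoAt o k l o = 2 := by simp [twoAt]
  have t2 : twoAt o k l k = 2 := by simp [twoAt]
  have t3 : twoAt o k l l = 2 := by simp [twoAt]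
  obtain ⟨r, hr⟩ : p ∣ threeRowMatrix p o k l X Y Z o.castSucc j.castSucc :=
    dvd_threeRowMatrix _ _
  obtain ⟨s, hs⟩ : p ∣ threeRowMatrix p o k l X Y Z k.castSucc j.castSucc :=
    dvd_threeRowMatrix _ _
  obtain ⟨t, ht⟩ : p ∣ threeRowMatrix p o k l X Y Z l.castSucc j.castSucc :=
    dvd_threeRowMatrix _ _
  rw [exists_threeRowMatrix_mulVec_eq_iff hp hok hkl hX hY hZ (u := 0) _ rfl rfl rfl]
  · simp only [hr, hs, ht, Pi.zero_apply, mul_zero, Finset.sum_const_zero, add_zero]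
    simp only [threeRowMatrix_castSucc]
    rcases hi with rfl | rfl | rfl
    · refine ⟨p * r, 0, 0, ?_, ?_, ?_⟩ <;>
        simp [hok.ne', hkl.ne', hol.ne', hok.ne, hkl.ne, hol.ne, t1, hX _ le_rfl, hY _ hok.le,
          hZ _ hol.le]
    · refine ⟨X i * r - X i * s, p * s, 0, ?_, ?_, ?_⟩ <;>
        simp [hok.ne', hkl.ne', hol.ne', hok.ne, hkl.ne, hol.ne, t2, hY _ le_rfl, hZ _ hkl.le]
      ring
    · refine ⟨X i * r - X i * t, Y i * s - Y i * t, p * t, ?_, ?_, ?_⟩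
      · simp [hkl.ne', hol.ne', t3, hZ _ le_rfl]
      · simp [hok.ne', hkl.ne]
        ring
      · simp [hok.ne, hol.ne]
        linear_combination p * (t - s) * hXY
  · intro r h1 h2 h3
    have h4 : r ≠ i := by rintro rfl; tauto
    simp [threeRowMatrix_castSucc, h1, h2, h3, h4]
  · simp [threeRowMatrix_last_castSucc]

lemma dvd_of_column_sq (hp : Prime p) (hok : o < k) (hkl : k < l)
    (hX : ∀ j, j ≤ o → X j = 0) (hY : ∀ j, j ≤ k → Y j = 0) (hZ : ∀ j, j ≤ l → Z j = 0)
    (h : ∃ x, (threeRowMatrix p o k l X Y Z).mulVec x = fun r =>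
      threeRowMatrix p o k l X Y Z r l.castSucc * threeRowMatrix p o k l X Y Z r l.castSucc) :
    p ∣ X k * Y l := by
  have hol := hok.trans hkl
  have hp2 : p ^ 2 ≠ 0 := pow_ne_zero _ hp.ne_zero
  rw [exists_threeRowMatrix_mulVec_eq_iff hp.ne_zero hok hkl hX hY hZ (u := 0) _ rfl rfl rfl] at h
  · have t3 : twoAt o k l l = 2 := by simp [twoAt]
    simp only [threeRowMatrix_castSucc, hok.ne, hok.ne', hkl.ne, hkl.ne', hol.ne, hol.ne', if_true,
      if_false, zero_add, add_zero, t3, hZ l le_rfl, mul_zero, Pi.zero_apply,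
      Finset.sum_const_zero] at h
    obtain ⟨a, b, c, hc, hb, ha⟩ := h
    have hc' : c = p ^ 2 := mul_left_cancel₀ hp2 (by linear_combination -hc)
    subst hc'
    have hb' : b = Y l * Y l - p * Y l := mul_left_cancel₀ hp2 (by linear_combination -hb)
    subst hb'
    have h2 : p ∣ X k * Y l * Y l := by
      refine ⟨X l * X l - a + X k * Y l - p * X l, mul_left_cancel₀ hp.ne_zero ?_⟩
      linear_combination -ha
    rcases hp.dvd_or_dvd h2 with h | h
    · exact h
    · exact h.mul_left _
  · intro r h1 h2 h3
    simp [threeRowMatrix_castSucc, h1, h2, h3]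
  · simp [threeRowMatrix_last_castSucc]

/-- The span of the columns of a three-row matrix is closed under componentwise products exactly
when a system of congruences holds. -/
lemma columns_mul_iff (hp : Prime p) (hok : o < k) (hkl : k < l)
    (hX : ∀ j, j ≤ o → X j = 0) (hY : ∀ j, j ≤ k → Y j = 0) (hZ : ∀ j, j ≤ l → Z j = 0)
    (hXY : p ∣ X k * Y l → X k * Y l = 0) :
    (∀ i j, ∃ x, (threeRowMatrix p o k l X Y Z).mulVec x = fun r =>
      threeRowMatrix p o k l X Y Z r i * threeRowMatrix p o k l X Y Z r j) ↔
      p ∣ X k * Y l ∧ ∀ i j, i ≠ o → i ≠ k → i ≠ l → j ≠ o → j ≠ k → j ≠ l →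
        p ∣ Y l * defect Z i j ∧ p ∣ X l * defect Z i j + X k * defect Y i j := by
  constructor
  · intro h
    have h0 := dvd_of_column_sq hp hok hkl hX hY hZ (h _ _)
    exact ⟨h0, fun i j h1 h2 h3 h4 h5 h6 =>
      (generic_column_mul_iff hp.ne_zero hok hkl hX hY hZ (hXY h0) h1 h2 h3 h4 h5 h6).1 (h _ _)⟩
  · rintro ⟨h0, h⟩ i j
    have col (j : Fin (m + 1)) : ∃ x, (threeRowMatrix p o k l X Y Z).mulVec x = fun r =>
        threeRowMatrix p o k l X Y Z r j :=
      ⟨Pi.single j 1, by ext r; simp⟩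
    refine Fin.lastCases ?_ (fun i => ?_) i
    · simpa [threeRowMatrix_last_right] using col j
    refine Fin.lastCases ?_ (fun j => ?_) j
    · simpa [threeRowMatrix_last_right] using col i.castSucc
    by_cases hi : i = o ∨ i = k ∨ i = l
    · exact special_column_mul hp.ne_zero hok hkl hX hY hZ (hXY h0) hi j
    by_cases hj : j = o ∨ j = k ∨ j = l
    · simpa only [mul_comm] using special_column_mul hp.ne_zero hok hkl hX hY hZ (hXY h0) hj i
    push Not at hi hj
    exact (generic_column_mul_iff hp.ne_zero hok hkl hX hY hZ (hXY h0) hi.1 hi.2.1 hi.2.2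
      hj.1 hj.2.1 hj.2.2).2 (h i j hi.1 hi.2.1 hi.2.2 hj.1 hj.2.1 hj.2.2)

end Characterization

section Residues

variable {m p : ℕ} {o k l : Fin m}

/-- The residues modulo `p` of the rows of an irreducible subring matrix with diagonal
`twoAt o k l`. -/
def IsThreeRowSolution (o k l : Fin m) (X Y Z : Fin m → ZMod p) : Prop :=
  ((∀ j, j ≤ o → X j = 0) ∧ (∀ j, j ≤ k → Y j = 0) ∧ (∀ j, j ≤ l → Z j = 0)) ∧
  X k * Y l = 0 ∧ ∀ i j, i ≠ o → i ≠ k → i ≠ l → j ≠ o → j ≠ k → j ≠ l →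
    Y l * defect Z i j = 0 ∧ X l * defect Z i j + X k * defect Y i j = 0

/-- The least nonnegative integer representatives of a family of residues. -/
def residueLift (V : Fin m → ZMod p) (j : Fin m) : ℤ := (V j).val

lemma residueLift_nonneg (V : Fin m → ZMod p) (j : Fin m) : 0 ≤ residueLift V j :=
  Int.natCast_nonneg _

variable [Fact p.Prime]

@[simp] lemma residueLift_cast (V : Fin m → ZMod p) (j : Fin m) :
    ((residueLift V j : ℤ) : ZMod p) = V j := by
  simp [residueLift]

lemma residueLift_lt (V : Fin m → ZMod p) (j : Fin m) : residueLift V j < p :=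
  Int.ofNat_lt.2 (ZMod.val_lt _)

lemma residueLift_eq_zero {V : Fin m → ZMod p} {j : Fin m} :
    residueLift V j = 0 ↔ V j = 0 :=
  Int.natCast_eq_zero.trans (ZMod.val_eq_zero _)

lemma residueLift_of_eq {V : Fin m → ZMod p} {j : Fin m} {x : ℤ} (h0 : 0 ≤ x) (h1 : x < p)
    (h : V j = x) : residueLift V j = x := by
  rw [residueLift, h, ZMod.val_intCast, Int.emod_eq_of_lt h0 h1]

lemma defect_residueLift_cast (V : Fin m → ZMod p) (i j : Fin m) :
    ((defect (residueLift V) i j : ℤ) : ZMod p) = defect V i j := by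
  unfold defect; split_ifs <;> simp

lemma isIrrSubringMatrix_threeRowMatrix_iff (hok : o < k) (hkl : k < l) {X Y Z : Fin m → ZMod p}
    (hX : ∀ j, j ≤ o → X j = 0) (hY : ∀ j, j ≤ k → Y j = 0) (hZ : ∀ j, j ≤ l → Z j = 0) :
    IsIrrSubringMatrix p (twoAt o k l)
      (threeRowMatrix p o k l (residueLift X) (residueLift Y) (residueLift Z)) ↔
      IsThreeRowSolution o k l X Y Z := by
  have hol := hok.trans hkl
  have hp : p.Prime := Fact.out
  have hX' : ∀ j, j ≤ o → residueLift X j = 0 := fun j hj => residueLift_eq_zero.2 (hX j hj)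
  have hY' : ∀ j, j ≤ k → residueLift Y j = 0 := fun j hj => residueLift_eq_zero.2 (hY j hj)
  have hZ' : ∀ j, j ≤ l → residueLift Z j = 0 := fun j hj => residueLift_eq_zero.2 (hZ j hj)
  have hXY : (p : ℤ) ∣ residueLift X k * residueLift Y l →
      residueLift X k * residueLift Y l = 0 := by
    intro h
    rw [← ZMod.intCast_zmod_eq_zero_iff_dvd] at h
    simpa [residueLift_eq_zero] using h
  have main := columns_mul_iff (Nat.prime_iff_prime_int.1 hp) hok hkl hX' hY' hZ' hXY
  simp only [← ZMod.intCast_zmod_eq_zero_iff_dvd, Int.cast_mul, Int.cast_add, residueLift_cast,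
    defect_residueLift_cast] at main
  unfold IsIrrSubringMatrix IsThreeRowSolution
  rw [main]
  have bound : ∀ V : Fin m → ZMod p, ∀ j, (p : ℤ) ∣ p * residueLift V j ∧
      0 ≤ p * residueLift V j ∧ p * residueLift V j < (p : ℤ) ^ 2 := fun V j =>
    ⟨dvd_mul_right _ _, mul_nonneg (by positivity) (residueLift_nonneg V j), by
      rw [pow_two]
      exact mul_lt_mul_of_pos_left (residueLift_lt V j) (by exact_mod_cast hp.pos)⟩
  refine ⟨fun h => ⟨⟨hX, hY, hZ⟩, h.2.2.2.2⟩, fun h => ⟨?_, ?_, ?_, ?_, h.2⟩⟩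
  · intro i j
    refine Fin.lastCases ?_ (fun j => ?_) j
    · simp; omega
    refine Fin.lastCases ?_ (fun i => ?_) i
    · simp [threeRowMatrix_last_castSucc]
    intro hij
    have hij : j < i := by simpa using hij
    rw [threeRowMatrix_castSucc]
    have hX1 : i = o → residueLift X j = 0 := fun h => hX' j (h ▸ hij.le)
    have hY1 : i = k → residueLift Y j = 0 := fun h => hY' j (h ▸ hij.le)
    have hZ1 : i = l → residueLift Z j = 0 := fun h => hZ' j (h ▸ hij.le)
    simp +contextual [hij.ne', hX1, hY1, hZ1]
  · intro i
    rw [threeRowMatrix_castSucc]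
    simp +contextual [hX' o le_rfl, hY' k le_rfl, hZ' l le_rfl]
  · exact threeRowMatrix_last_right
  · intro i j hij
    have hij : i < j := hij
    rw [threeRowMatrix_castSucc]
    by_cases h1 : i = o
    · subst h1
      simpa [hij.ne, hok.ne, hol.ne, twoAt] using bound X j
    by_cases h2 : i = k
    · subst h2
      simpa [hij.ne, hok.ne', hkl.ne, twoAt] using bound Y j
    by_cases h3 : i = l
    · subst h3
      simpa [hij.ne, hol.ne', hkl.ne', twoAt] using bound Z j
    simp [hij.ne, h1, h2, h3, twoAt, hp.pos]

lemma exists_threeRowMatrix_eq (hok : o < k) (hkl : k < l)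
    {A : Matrix (Fin (m + 1)) (Fin (m + 1)) ℤ} (hA : IsIrrSubringMatrix p (twoAt o k l) A) :
    ∃ X Y Z : Fin m → ZMod p,
      (∀ j, j ≤ o → X j = 0) ∧ (∀ j, j ≤ k → Y j = 0) ∧ (∀ j, j ≤ l → Z j = 0) ∧
      threeRowMatrix p o k l (residueLift X) (residueLift Y) (residueLift Z) = A := by
  have hol := hok.trans hkl
  have hp : p.Prime := Fact.out
  obtain ⟨htri, hdiag, hlast, hupper, -⟩ := hA
  let row (r j : Fin m) : ZMod p :=
    if r < j then ((A r.castSucc j.castSucc / p : ℤ) : ZMod p) else 0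
  have row_of_le (r j : Fin m) (h : j ≤ r) : row r j = 0 := by simp [row, h.not_gt]
  have row_eq (r j : Fin m) (hr : twoAt o k l r = 2) (h : r < j) :
      p * residueLift (row r) j = A r.castSucc j.castSucc := by
    obtain ⟨⟨t, ht⟩, h0, h1⟩ := hupper r j h
    have hpos : (0 : ℤ) < p := by exact_mod_cast hp.pos
    have htA : A r.castSucc j.castSucc / p = t := by rw [ht, Int.mul_ediv_cancel_left _ hpos.ne']
    rw [ht] at h0 h1
    rw [hr, pow_two] at h1
    rw [residueLift_of_eq (x := t), ht]
    · exact nonneg_of_mul_nonneg_right h0 hpos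
    · exact lt_of_mul_lt_mul_left h1 hpos.le
    · simp [row, h, htA]
  refine ⟨row o, row k, row l, row_of_le o, row_of_le k, row_of_le l, ?_⟩
  ext i j
  refine Fin.lastCases ?_ (fun j => ?_) j
  · rw [threeRowMatrix_last_right, hlast]
  refine Fin.lastCases ?_ (fun i => ?_) i
  · rw [threeRowMatrix_last_castSucc, htri _ _ (by simp)]
  have lift_of_le (r : Fin m) (h : j ≤ r) : residueLift (row r) j = 0 :=
    residueLift_eq_zero.2 (row_of_le r j h)
  rw [threeRowMatrix_castSucc]
  rcases lt_trichotomy i j with hij | hij | hij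
  · by_cases h1 : i = o
    · subst h1
      simpa [hij.ne, hok.ne, hol.ne] using row_eq i j (by simp [twoAt]) hij
    by_cases h2 : i = k
    · subst h2
      simpa [hij.ne, hok.ne', hkl.ne] using row_eq i j (by simp [twoAt]) hij
    by_cases h3 : i = l
    · subst h3
      simpa [hij.ne, hol.ne', hkl.ne'] using row_eq i j (by simp [twoAt]) hij
    obtain ⟨hd, h0, hlt⟩ := hupper i j hij
    simp only [twoAt, h1, h2, h3, or_self, if_false, pow_one] at hlt
    simp [h1, h2, h3, hij.ne, Int.eq_zero_of_dvd_of_nonneg_of_lt h0 hlt hd]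
  · subst hij
    rw [hdiag]
    have self (r : Fin m) : residueLift (row r) r = 0 :=
      residueLift_eq_zero.2 (row_of_le r r le_rfl)
    simp +contextual [self]
  · rw [htri _ _ (by simpa using hij)]
    have hX1 : i = o → residueLift (row o) j = 0 := fun h => lift_of_le o (h ▸ hij.le)
    have hY1 : i = k → residueLift (row k) j = 0 := fun h => lift_of_le k (h ▸ hij.le)
    have hZ1 : i = l → residueLift (row l) j = 0 := fun h => lift_of_le l (h ▸ hij.le)
    simp +contextual [hij.ne', hX1, hY1, hZ1]

lemma row_eq_of_threeRowMatrix_eq {X Y Z X' Y' Z' : Fin m → ZMod p} (hok : o < k) (hkl : k < l)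
    (h : threeRowMatrix p o k l (residueLift X) (residueLift Y) (residueLift Z) =
      threeRowMatrix p o k l (residueLift X') (residueLift Y') (residueLift Z')) :
    X = X' ∧ Y = Y' ∧ Z = Z' := by
  have hol := hok.trans hkl
  have hp : p ≠ 0 := (Fact.out : p.Prime).ne_zero
  have entry (i j : Fin m) := congrFun (congrFun h i.castSucc) j.castSucc
  simp only [threeRowMatrix_castSucc, add_assoc, add_right_inj] at entry
  have lift_inj {V V' : Fin m → ZMod p} {j : Fin m} (h : residueLift V j = residueLift V' j) :
      V j = V' j := by rw [← residueLift_cast V, h, residueLift_cast]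
  refine ⟨funext fun j => lift_inj ?_, funext fun j => lift_inj ?_, funext fun j => lift_inj ?_⟩
  · simpa [hp, hok.ne, hol.ne] using entry o j
  · simpa [hp, hok.ne', hkl.ne] using entry k j
  · simpa [hp, hol.ne', hkl.ne'] using entry l j

lemma gMat_twoAt (hok : o < k) (hkl : k < l) :
    gMat p (twoAt o k l) = Nat.card {V : (Fin m → ZMod p) × (Fin m → ZMod p) × (Fin m → ZMod p) //
      IsThreeRowSolution o k l V.1 V.2.1 V.2.2} := by
  refine (Nat.card_eq_of_bijective (fun V => ⟨threeRowMatrix p o k l (residueLift V.1.1)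
    (residueLift V.1.2.1) (residueLift V.1.2.2), (isIrrSubringMatrix_threeRowMatrix_iff hok hkl
      V.2.1.1 V.2.1.2.1 V.2.1.2.2).2 V.2⟩) ⟨?_, ?_⟩).symm
  · rintro ⟨⟨X, Y, Z⟩, hV⟩ ⟨⟨X', Y', Z'⟩, hV'⟩ h
    obtain ⟨rfl, rfl, rfl⟩ := row_eq_of_threeRowMatrix_eq hok hkl (congrArg Subtype.val h)
    rfl
  · rintro ⟨A, hA⟩
    obtain ⟨X, Y, Z, hX, hY, hZ, rfl⟩ := exists_threeRowMatrix_eq hok hkl hA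
    exact ⟨⟨(X, Y, Z), (isIrrSubringMatrix_threeRowMatrix_iff hok hkl hX hY hZ).1 hA⟩, rfl⟩

end Residues

section Blocks

variable {F S T : Type*} [CommRing F] [DecidableEq S] [DecidableEq T]

/-- The conditions of `IsThreeRowSolution`, in terms of the entries `(a, b, d)` in the positions
`(o, k)`, `(k, l)`, `(o, l)` and of the entries in the generic columns between `k` and `l` (indexed
by `S`) and beyond `l` (indexed by `T`). -/
def IsBlockSolution (c : F × F × F) (v : (S → F) × (T → F) × (T → F)) : Prop :=
  c.1 * c.2.1 = 0 ∧ (∀ i j, c.2.1 * defect v.2.2 i j = 0) ∧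
  (∀ i j, c.2.2 * defect v.2.2 i j + c.1 * defect v.2.1 i j = 0) ∧
  (∀ i j, c.1 * defect v.1 i j = 0) ∧ ∀ i j, c.1 * (v.1 i * v.2.1 j) = 0

lemma defect_of_ne {V : S → F} {i j : S} (h : i ≠ j) : defect V i j = V i * V j := by
  simp [defect, h]

lemma defect_of_eq_zero_left {V : S → F} {i j : S} (hi : V i = 0) : defect V i j = 0 := by
  simp [defect, hi]

lemma defect_of_eq_zero_right {V : S → F} {i j : S} (hj : V j = 0) : defect V i j = 0 := by
  by_cases h : i = j <;> simp [defect, hj, h]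

lemma defect_comp_subtype {P : S → Prop} (V : S → F) (i j : {i // P i}) :
    defect (fun i : {i // P i} => V i) i j = defect V i j := by
  simp [defect, Subtype.ext_iff]

end Blocks

section Restriction

variable {m p : ℕ} {o k l : Fin m}

lemma isThreeRowSolution_iff_blocks (hok : o < k) (hkl : k < l) {X Y Z : Fin m → ZMod p}
    (hX : ∀ j, j ≤ o → X j = 0) (hY : ∀ j, j ≤ k → Y j = 0) (hZ : ∀ j, j ≤ l → Z j = 0) :
    IsThreeRowSolution o k l X Y Z ↔
      IsBlockSolution (X k, Y l, X l) (fun i : {i // k < i ∧ i < l} => Y i,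
        fun i : {i // l < i} => Y i, fun i : {i // l < i} => Z i) := by
  have hol := hok.trans hkl
  simp only [IsThreeRowSolution, IsBlockSolution, defect_comp_subtype, Subtype.forall]
  constructor
  · rintro ⟨-, h0, h⟩
    refine ⟨h0, fun i hi j hj => ?_, fun i hi j hj => ?_, fun i hi j hj => ?_, fun i hi j hj => ?_⟩
    · exact (h i j (hol.trans hi).ne' (hkl.trans hi).ne' hi.ne' (hol.trans hj).ne'
        (hkl.trans hj).ne' hj.ne').1
    · exact (h i j (hol.trans hi).ne' (hkl.trans hi).ne' hi.ne' (hol.trans hj).ne'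
        (hkl.trans hj).ne' hj.ne').2
    · simpa [defect_of_eq_zero_left (hZ i hi.2.le)] using (h i j (hok.trans hi.1).ne' hi.1.ne'
        hi.2.ne (hok.trans hj.1).ne' hj.1.ne' hj.2.ne).2
    · simpa [defect_of_eq_zero_left (hZ i hi.2.le), defect_of_ne (hi.2.trans hj).ne] using
        (h i j (hok.trans hi.1).ne' hi.1.ne' hi.2.ne (hol.trans hj).ne' (hkl.trans hj).ne' hj.ne').2
  · rintro ⟨h0, h1, h2, h3, h4⟩
    refine ⟨⟨hX, hY, hZ⟩, h0, fun i j _ hik hil _ hjk hjl => ?_⟩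
    rcases lt_or_gt_of_ne hil with hi | hi <;> rcases lt_or_gt_of_ne hjl with hj | hj
    · rcases lt_or_gt_of_ne hik with hi' | hi'
      · simp [defect_of_eq_zero_left (hY i hi'.le), defect_of_eq_zero_left (hZ i hi.le)]
      rcases lt_or_gt_of_ne hjk with hj' | hj'
      · simp [defect_of_eq_zero_right (hY j hj'.le), defect_of_eq_zero_right (hZ j hj.le)]
      simp [defect_of_eq_zero_left (hZ i hi.le), h3 i ⟨hi', hi⟩ j ⟨hj', hj⟩]
    · rcases lt_or_gt_of_ne hik with hi' | hi'
      · simp [defect_of_eq_zero_left (hY i hi'.le), defect_of_eq_zero_left (hZ i hi.le)]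
      simpa [defect_of_eq_zero_left (hZ i hi.le), defect_of_ne (hi.trans hj).ne] using
        h4 i ⟨hi', hi⟩ j hj
    · rcases lt_or_gt_of_ne hjk with hj' | hj'
      · simp [defect_of_eq_zero_right (hY j hj'.le), defect_of_eq_zero_right (hZ j hj.le)]
      simpa [defect_of_eq_zero_right (hZ j hj.le), defect_of_ne (hj.trans hi).ne',
        mul_comm (Y i)] using h4 j ⟨hj', hj⟩ i hi
    · exact ⟨h1 i hi j hj, h2 i hi j hj⟩

lemma card_isThreeRowSolution (hok : o < k) (hkl : k < l) :
    Nat.card {V : (Fin m → ZMod p) × (Fin m → ZMod p) × (Fin m → ZMod p) //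
      IsThreeRowSolution o k l V.1 V.2.1 V.2.2} =
    Nat.card (({i // o < i ∧ i ≠ k ∧ i ≠ l} → ZMod p) ×
      {c : (ZMod p × ZMod p × ZMod p) × (({i // k < i ∧ i < l} → ZMod p) ×
        ({i // l < i} → ZMod p) × ({i // l < i} → ZMod p)) // IsBlockSolution c.1 c.2}) := by
  have hol := hok.trans hkl
  refine Nat.card_eq_of_bijective (fun V => (fun i => V.1.1 i,
    ⟨((V.1.1 k, V.1.2.1 l, V.1.1 l), (fun i => V.1.2.1 i, fun i => V.1.2.1 i, fun i => V.1.2.2 i)),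
      (isThreeRowSolution_iff_blocks hok hkl V.2.1.1 V.2.1.2.1 V.2.1.2.2).1 V.2⟩)) ⟨?_, ?_⟩
  · rintro ⟨⟨X, Y, Z⟩, ⟨hX, hY, hZ⟩, _⟩ ⟨⟨X', Y', Z'⟩, ⟨hX', hY', hZ'⟩, _⟩ h
    simp only [Prod.mk.injEq, Subtype.mk.injEq, funext_iff, Subtype.forall] at h
    dsimp only at hX hY hZ hX' hY' hZ'
    obtain ⟨h1, ⟨h2, h3, h4⟩, h5, h6, h7⟩ := h
    refine Subtype.ext (Prod.ext (funext fun j => ?_) (Prod.ext (funext fun j => ?_)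
      (funext fun j => ?_)))
    · change X j = X' j
      by_cases hj : j ≤ o
      · rw [hX j hj, hX' j hj]
      by_cases hjk : j = k
      · rw [hjk, h2]
      by_cases hjl : j = l
      · rw [hjl, h4]
      exact h1 j ⟨not_le.1 hj, hjk, hjl⟩
    · change Y j = Y' j
      by_cases hj : j ≤ k
      · rw [hY j hj, hY' j hj]
      rcases lt_trichotomy j l with hjl | hjl | hjl
      · exact h5 j ⟨not_le.1 hj, hjl⟩
      · rw [hjl, h3]
      · exact h6 j hjl
    · change Z j = Z' j
      by_cases hj : j ≤ l
      · rw [hZ j hj, hZ' j hj]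
      exact h7 j (not_le.1 hj)
  · rintro ⟨x, ⟨⟨a, b, d⟩, y, y', z⟩, h⟩
    let X : Fin m → ZMod p := fun j => if hj : o < j ∧ j ≠ k ∧ j ≠ l then x ⟨j, hj⟩ else
      if j = k then a else if j = l then d else 0
    let Y : Fin m → ZMod p := fun j => if hj : k < j ∧ j < l then y ⟨j, hj⟩ else
      if hj : l < j then y' ⟨j, hj⟩ else if j = l then b else 0
    let Z : Fin m → ZMod p := fun j => if hj : l < j then z ⟨j, hj⟩ else 0
    have hX : ∀ j, j ≤ o → X j = 0 := fun j hj => by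
      simp [X, hj.not_gt, (hj.trans_lt hok).ne, (hj.trans_lt hol).ne]
    have hY : ∀ j, j ≤ k → Y j = 0 := fun j hj => by
      simp [Y, hj.not_gt, (hj.trans_lt hkl).ne, (hj.trans_lt hkl).not_gt]
    have hZ : ∀ j, j ≤ l → Z j = 0 := fun j hj => by simp [Z, hj.not_gt]
    have e : ((X k, Y l, X l), (fun i : {i // k < i ∧ i < l} => Y i,
        fun i : {i // l < i} => Y i, fun i : {i // l < i} => Z i)) = ((a, b, d), y, y', z) := by
      simp only [Prod.mk.injEq, funext_iff, Subtype.forall]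
      refine ⟨⟨?_, ?_, ?_⟩, fun i hi => ?_, fun i hi => ?_, fun i hi => ?_⟩
      · simp [X]
      · simp [Y]
      · simp [X, hkl.ne']
      · simp [Y, hi]
      · simp [Y, hi, hi.not_gt]
      · simp [Z, hi]
    refine ⟨⟨(X, Y, Z), (isThreeRowSolution_iff_blocks hok hkl hX hY hZ).2 ?_⟩, ?_⟩
    · simp only [Prod.mk.injEq] at e
      rw [e.1.1, e.1.2.1, e.1.2.2, e.2.1, e.2.2.1, e.2.2.2]
      exact h
    · refine Prod.ext (funext fun i => ?_) (Subtype.ext e)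
      simp [X, i.2]

end Restriction

section Counting

variable {F S T : Type*} [Field F] [DecidableEq S] [DecidableEq T]

lemma single_one_defect (i j r : T) : defect (Pi.single r 1 : T → F) i j = 0 := by
  simp only [defect, Pi.single_apply]
  split_ifs <;> simp_all

/-- A family of orthogonal idempotents in a field has at most one nonzero member. -/
lemma eq_zero_or_single_of_defect_eq_zero {z : T → F} (h : ∀ i j, defect z i j = 0) :
    z = 0 ∨ ∃ r, z = Pi.single r 1 := by
  by_cases h0 : ∃ r, z r ≠ 0
  · obtain ⟨r, hr⟩ := h0
    refine Or.inr ⟨r, funext fun i => ?_⟩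
    have hri := h r i
    by_cases hi : r = i
    · subst hi
      simp only [defect, if_true] at hri
      have : z r * (z r - 1) = 0 := by linear_combination hri
      simpa [hr, sub_eq_zero] using this
    · rw [defect_of_ne hi] at hri
      simpa [hr, Ne.symm hi] using hri
  · push Not at h0
    exact Or.inl (funext h0)

variable [Fintype T]

lemma card_orthogonal_idempotents :
    Nat.card {z : T → F // ∀ i j, defect z i j = 0} = Fintype.card T + 1 := by
  rw [← Fintype.card_option, ← Nat.card_eq_fintype_card]
  have mem (r : Option T) (i j : T) :
      defect (r.elim 0 fun r => Pi.single r 1 : T → F) i j = 0 := by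
    cases r
    · simp [defect]
    · exact single_one_defect i j _
  refine (Nat.card_eq_of_bijective (fun r : Option T => ⟨r.elim 0 fun r => Pi.single r 1, mem r⟩)
    ⟨?_, ?_⟩).symm
  · intro r r' h
    have h := congrArg Subtype.val h
    rcases r with _ | r <;> rcases r' with _ | r'
    · rfl
    · simpa using (congrFun h r').symm
    · simpa using congrFun h r
    · have := congrFun h r
      by_contra hne
      simp_all [Pi.single_apply]
  · rintro ⟨z, hz⟩
    rcases eq_zero_or_single_of_defect_eq_zero hz with rfl | ⟨r, rfl⟩
    · exact ⟨none, rfl⟩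
    · exact ⟨some r, rfl⟩

lemma card_subtype_snd {A B : Type*} (P : B → Prop) :
    Nat.card {v : A × B // P v.2} = Nat.card A * Nat.card {b // P b} := by
  rw [← Nat.card_prod]
  exact Nat.card_congr
    { toFun := fun v => (v.1.1, ⟨v.1.2, v.2⟩)
      invFun := fun v => ⟨(v.1, v.2.1), v.2.2⟩
      left_inv := fun _ => rfl
      right_inv := fun _ => rfl }

variable [Fintype F] [Fintype S]

/-- Two families that together are orthogonal idempotents. -/
lemma card_orthogonal_idempotents_pair :
    Nat.card {v : (S → F) × (T → F) × (T → F) // (∀ i j, defect v.2.1 i j = 0) ∧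
      (∀ i j, defect v.1 i j = 0) ∧ ∀ i j, v.1 i * v.2.1 j = 0} =
    (Fintype.card S + Fintype.card T + 1) * Fintype.card F ^ Fintype.card T := by
  have h1 := card_orthogonal_idempotents (F := F) (T := S ⊕ T)
  rw [Fintype.card_sum] at h1
  have h2 : Nat.card (T → F) = Fintype.card F ^ Fintype.card T := by simp
  rw [← h1, ← h2, ← Nat.card_prod]
  refine Nat.card_congr
    { toFun := fun v => (⟨Sum.elim v.1.1 v.1.2.1, ?_⟩, v.1.2.2)
      invFun := fun v => ⟨(fun i => v.1.1 (.inl i), fun i => v.1.1 (.inr i), v.2), ?_⟩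
      left_inv := fun _ => rfl
      right_inv := fun v => by
        refine Prod.ext (Subtype.ext (funext fun i => ?_)) rfl
        rcases i with i | i <;> rfl }
  · obtain ⟨h1, h2, h3⟩ := v.2
    rintro (i | i) (j | j)
    · simpa [defect] using h2 i j
    · simpa [defect] using h3 i j
    · simpa [defect, mul_comm] using h3 j i
    · simpa [defect] using h1 i j
  · have h := v.1.2
    refine ⟨fun i j => ?_, fun i j => ?_, fun i j => ?_⟩
    · simpa [defect] using h (.inr i) (.inr j)
    · simpa [defect] using h (.inl i) (.inl j)
    · simpa [defect] using h (.inl i) (.inr j)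

/-- Families of points of the plane that are orthogonal idempotents on average, with weights
`1` and `c`. -/
def IsConicFamily (c : F) (v : (T → F) × (T → F)) : Prop :=
  ∀ i j, defect v.1 i j + c * defect v.2 i j = 0

lemma card_conic_blocks {c : F} (hc : c ≠ 0) :
    Nat.card {v : (S → F) × (T → F) × (T → F) // IsConicFamily c v.2 ∧
      (∀ i j, defect v.1 i j = 0) ∧ ∀ i j, v.1 i * v.2.1 j = 0} =
    Fintype.card S * (Fintype.card T + 1) +
      Nat.card {v : (T → F) × (T → F) // IsConicFamily c v} := by
  rw [← card_orthogonal_idempotents (F := F) (T := T), ← Nat.card_eq_fintype_card (α := S),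
    ← Nat.card_prod, ← Nat.card_sum]
  have mem₁ (r : S) (z : {z : T → F // ∀ i j, defect z i j = 0}) :
      IsConicFamily c (0, z.1) ∧ (∀ i j, defect (Pi.single r 1 : S → F) i j = 0) ∧
        ∀ i j, (Pi.single r 1 : S → F) i * (0 : T → F) j = 0 := by
    refine ⟨fun i j => ?_, fun i j => single_one_defect i j _, by simp⟩
    rw [z.2 i j]
    simp [defect]
  have mem₂ (v : {v : (T → F) × (T → F) // IsConicFamily c v}) :
      IsConicFamily c v.1 ∧ (∀ i j, defect (0 : S → F) i j = 0) ∧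
        ∀ i j, (0 : S → F) i * v.1.1 j = 0 := ⟨v.2, by simp [defect], by simp⟩
  refine (Nat.card_eq_of_bijective (Sum.elim
    (fun r => ⟨(Pi.single r.1 1, 0, r.2.1), mem₁ r.1 r.2⟩)
    (fun v => ⟨(0, v.1), mem₂ v⟩)) ⟨?_, ?_⟩).symm
  · rintro (⟨r, z, hz⟩ | ⟨⟨y, z⟩, hv⟩) (⟨r', z', hz'⟩ | ⟨⟨y', z'⟩, hv'⟩) h
    · have h := congrArg Subtype.val h
      simp only [Sum.elim_inl, Prod.mk.injEq] at h
      obtain ⟨h1, -, rfl⟩ := h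
      have := congrFun h1 r
      have : r = r' := by
        by_contra hne
        simp_all
      simp [this]
    · have h := congrArg Subtype.val h
      simp only [Sum.elim_inl, Sum.elim_inr, Prod.mk.injEq] at h
      simpa using congrFun h.1 r
    · have h := congrArg Subtype.val h
      simp only [Sum.elim_inl, Sum.elim_inr, Prod.mk.injEq] at h
      simpa using congrFun h.1 r'
    · have h := congrArg Subtype.val h
      simp only [Sum.elim_inr, Prod.mk.injEq] at h
      obtain ⟨-, rfl, rfl⟩ := h
      rfl
  · rintro ⟨⟨y, y', z⟩, h1, h2, h3⟩
    rcases eq_zero_or_single_of_defect_eq_zero h2 with h | ⟨r, h⟩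
    · dsimp only at h
      subst h
      exact ⟨.inr ⟨(y', z), h1⟩, rfl⟩
    · dsimp only at h h3
      subst h
      have hy' : y' = 0 := funext fun j => by simpa using h3 r j
      subst hy'
      refine ⟨.inl (r, ⟨z, fun i j => ?_⟩), rfl⟩
      simpa [defect_of_eq_zero_left, hc] using h1 i j

end Counting

section Conic

variable {F T : Type*} [Field F] [DecidableEq T]

lemma card_subtype_split {A : Type*} [Finite A] (P Q : A → Prop) :
    Nat.card {x // P x} = Nat.card {x // P x ∧ Q x} + Nat.card {x // P x ∧ ¬ Q x} := by
  classical
  rw [← Nat.card_sum]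
  exact Nat.card_congr (((Equiv.subtypeSubtypeEquivSubtypeInter P Q).symm.sumCongr
    (Equiv.subtypeSubtypeEquivSubtypeInter P fun x => ¬ Q x).symm).trans
      (Equiv.sumCompl fun x : {x // P x} => Q x)).symm

/-- The quadratic form of `w - 1` relative to `w` vanishes. -/
def IsConicPoint (c : F) (w : F × F) : Prop := w.1 * w.1 - w.1 + c * (w.2 * w.2 - w.2) = 0

/-- A nonisotropic point of the conic. -/
def IsAnisotropicConicPoint (c : F) (w : F × F) : Prop := IsConicPoint c w ∧ w.1 + c * w.2 ≠ 0

/-- A family of pairwise orthogonal points of the conic. -/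
def IsOrthogonalConicFamily (c : F) (u : T → F × F) : Prop :=
  (∀ i, IsConicPoint c (u i)) ∧
    ∀ i j, i ≠ j → (u i).1 * (u j).1 + c * ((u i).2 * (u j).2) = 0

lemma card_isConicFamily (c : F) :
    Nat.card {v : (T → F) × (T → F) // IsConicFamily c v} =
      Nat.card {u : T → F × F // IsOrthogonalConicFamily c u} := by
  refine Nat.card_congr ((Equiv.arrowProdEquivProdArrow T (fun _ => F) fun _ => F).subtypeEquiv
    fun u => ?_).symm
  constructor
  · rintro ⟨h1, h2⟩ i j
    by_cases hij : i = j
    · subst hij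
      simpa [defect, IsConicPoint] using h1 i
    · simpa [defect, hij] using h2 i j hij
  · intro h
    refine ⟨fun i => ?_, fun i j hij => ?_⟩
    · simpa [defect, IsConicPoint] using h i i
    · simpa [defect, hij] using h i j

section Points

variable {c : F} {u v : F × F}

/-- The only points of the conic orthogonal to a nonisotropic point `u` are `0` and `1 - u`. -/
lemma IsAnisotropicConicPoint.eq_zero_or_eq_one_sub (hc : c ≠ 0)
    (hu : IsAnisotropicConicPoint c u) (hv : IsConicPoint c v)
    (huv : u.1 * v.1 + c * (u.2 * v.2) = 0) : v = 0 ∨ v = 1 - u := by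
  obtain ⟨y, z⟩ := u
  obtain ⟨y', z'⟩ := v
  obtain ⟨hu, hf⟩ := hu
  simp only [IsConicPoint] at hu hv hf huv
  obtain ⟨μ, h1, h2⟩ : ∃ μ, y' = μ * (c * z) ∧ z' = -(μ * y) := by
    by_cases hy : y = 0
    · have hz : z ≠ 0 := by rintro rfl; simp [hy] at hf
      refine ⟨y' / (c * z), by field_simp, ?_⟩
      subst hy
      simpa [hc, hz] using huv
    · refine ⟨-z' / y, ?_, by field_simp⟩
      field_simp
      linear_combination huv
  subst h1 h2
  have key : μ * (μ * (y + c * z) - (z - y)) = 0 :=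
    mul_left_cancel₀ hc (by linear_combination hv - c * μ ^ 2 * hu)
  rcases mul_eq_zero.1 key with h | h
  · left; simp [h]
  · right
    refine Prod.ext ?_ ?_
    · exact mul_left_cancel₀ hf (show (y + c * z) * (μ * (c * z)) = (y + c * z) * (1 - y) by
        linear_combination c * z * h + hu)
    · exact mul_left_cancel₀ hf (show (y + c * z) * -(μ * y) = (y + c * z) * (1 - z) by
        linear_combination -y * h + hu)

lemma IsConicPoint.one_sub (hu : IsConicPoint c u) : IsConicPoint c (1 - u) := by
  simp only [IsConicPoint, Prod.fst_sub, Prod.snd_sub, Prod.fst_one, Prod.snd_one] at hu ⊢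
  linear_combination hu

lemma IsConicPoint.orthogonal_one_sub (hu : IsConicPoint c u) :
    u.1 * (1 - u).1 + c * (u.2 * (1 - u).2) = 0 := by
  simp only [IsConicPoint, Prod.fst_sub, Prod.snd_sub, Prod.fst_one, Prod.snd_one] at hu ⊢
  linear_combination -hu

lemma IsAnisotropicConicPoint.one_sub (hc : c ≠ 0) (hu : IsAnisotropicConicPoint c u)
    (h1 : u ≠ 1) : IsAnisotropicConicPoint c (1 - u) := by
  refine ⟨hu.1.one_sub, fun h => h1 ?_⟩
  obtain ⟨y, z⟩ := u
  obtain ⟨hu, hf⟩ := hu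
  simp only [IsConicPoint, Prod.fst_sub, Prod.snd_sub, Prod.fst_one, Prod.snd_one] at hu hf h
  have hzy : (z - y) * (z - y) = 0 :=
    mul_left_cancel₀ hc (by linear_combination (y + c * z) * h + (1 + c) * hu)
  have hzy : z = y := by simpa [sub_eq_zero] using hzy
  subst hzy
  have hz : z - 1 = 0 := mul_left_cancel₀ hf (by linear_combination hu)
  simp [sub_eq_zero.1 hz]

lemma IsAnisotropicConicPoint.ne_zero (hu : IsAnisotropicConicPoint c u) : u ≠ 0 := by
  rintro rfl
  simp [IsAnisotropicConicPoint] at hu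

lemma isConicPoint_zero : IsConicPoint c 0 := by simp [IsConicPoint]

end Points

lemma IsOrthogonalConicFamily.eq_single_or_eq_add {c : F} (hc : c ≠ 0) {u : T → F × F}
    (h : IsOrthogonalConicFamily c u) {i : T} (hi : IsAnisotropicConicPoint c (u i)) :
    u = Pi.single i (u i) ∨
      u i ≠ 1 ∧ ∃ j, j ≠ i ∧ u = Pi.single i (u i) + Pi.single j (1 - u i) := by
  have other (j : T) (hj : j ≠ i) : u j = 0 ∨ u j = 1 - u i :=
    hi.eq_zero_or_eq_one_sub hc (h.1 j) (h.2 i j hj.symm)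
  by_cases h0 : ∃ j, j ≠ i ∧ u j ≠ 0
  · right
    obtain ⟨j, hj, hj0⟩ := h0
    have huj := (other j hj).resolve_left hj0
    have h1 : u i ≠ 1 := fun h => hj0 (by rw [huj, h, sub_self])
    have hja := hi.one_sub hc h1
    refine ⟨h1, j, hj, funext fun r => ?_⟩
    by_cases hri : r = i
    · subst hri; simp [hj.symm]
    by_cases hrj : r = j
    · subst hrj; simp [hj, huj]
    have : u r = 0 := by
      by_contra hr0
      have hur := (other r hri).resolve_left hr0
      have h2 := h.2 r j hrj
      rw [hur, huj] at h2
      refine hja.2 ?_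
      have h3 := hja.1
      simp only [IsConicPoint] at h3
      linear_combination h2 - h3
    simp [this, hri, hrj]
  · left
    push Not at h0
    refine funext fun r => ?_
    by_cases hri : r = i
    · subst hri; simp
    · simp [hri, h0 r hri]

lemma isOrthogonalConicFamily_single {c : F} {w : F × F} (hw : IsConicPoint c w) (i : T) :
    IsOrthogonalConicFamily c (Pi.single i w) := by
  refine ⟨fun r => ?_, fun r s hrs => ?_⟩
  · by_cases hr : r = i
    · subst hr; simpa
    · simpa [hr] using isConicPoint_zero
  · by_cases hr : r = i
    · subst hr; simp [hrs.symm]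
    · simp [hr]

lemma isOrthogonalConicFamily_add {c : F} {w : F × F} (hw : IsConicPoint c w) {i j : T}
    (hij : i ≠ j) : IsOrthogonalConicFamily c (Pi.single i w + Pi.single j (1 - w)) := by
  have ho := hw.orthogonal_one_sub
  refine ⟨fun r => ?_, fun r s hrs => ?_⟩
  · by_cases hr : r = i
    · subst hr; simpa [hij]
    by_cases hr' : r = j
    · subst hr'; simpa [hr] using hw.one_sub
    · simpa [hr, hr'] using isConicPoint_zero
  · by_cases hr : r = i
    · subst hr
      by_cases hs : s = j
      · subst hs; simpa [hij, hrs.symm] using ho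
      · simp [hs, hrs.symm]
    by_cases hr' : r = j
    · subst hr'
      by_cases hs : s = i
      · subst hs; simpa [hij, hr, mul_comm] using ho
      · simp [hs, hrs.symm]
    · simp [hr, hr']

lemma card_pairs {ι : Type*} {t : ℕ} (e : ι ≃ Fin t) :
    Nat.card {r : ι × ι // e r.1 < e r.2} = t.choose 2 := by
  rw [Nat.card_congr ((e.prodCongr e).subtypeEquiv (p := fun r => e r.1 < e r.2)
    (q := fun r => r.1 < r.2) fun _ => Iff.rfl),
    Nat.card_congr (Equiv.subtypeProdEquivSigmaSubtype fun i j : Fin t => i < j), Nat.card_sigma]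
  have : ∀ i : Fin t, Nat.card {j : Fin t // i < j} = t - 1 - i := fun i => by
    rw [Nat.card_eq_fintype_card, Fintype.card_subtype, Finset.filter_lt_eq_Ioi, Fin.card_Ioi]
  rw [Finset.sum_congr rfl fun i _ => this i, Fin.sum_univ_eq_sum_range fun i => t - 1 - i,
    Finset.sum_range_reflect (fun i => i), Finset.sum_range_id, Nat.choose_two_right]

variable [Fintype F] [Fintype T]

lemma card_anisotropic_families {c : F} (hc : c ≠ 0) :
    Nat.card {u : T → F × F // IsOrthogonalConicFamily c u ∧ ¬ ∀ i, (u i).1 + c * (u i).2 = 0} =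
      Fintype.card T * Nat.card {w : F × F // IsAnisotropicConicPoint c w} +
      (Fintype.card T).choose 2 *
        Nat.card {w : F × F // IsAnisotropicConicPoint c w ∧ w ≠ 1} := by
  let e := Finite.equivFin T
  rw [← Nat.card_eq_fintype_card (α := T), ← card_pairs e, ← Nat.card_prod, ← Nat.card_prod,
    ← Nat.card_sum]
  have mem₁ (i : T) (w : {w : F × F // IsAnisotropicConicPoint c w}) :
      IsOrthogonalConicFamily c (Pi.single i w.1) ∧
        ¬ ∀ r, ((Pi.single i w.1 : T → F × F) r).1 + c * ((Pi.single i w.1 : T → F × F) r).2 = 0 :=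
    ⟨isOrthogonalConicFamily_single w.2.1 i, fun h => w.2.2 (by simpa using h i)⟩
  have mem₂ (r : {r : T × T // e r.1 < e r.2})
      (w : {w : F × F // IsAnisotropicConicPoint c w ∧ w ≠ 1}) :
      IsOrthogonalConicFamily c (Pi.single r.1.1 w.1 + Pi.single r.1.2 (1 - w.1)) ∧
        ¬ ∀ s, ((Pi.single r.1.1 w.1 + Pi.single r.1.2 (1 - w.1) : T → F × F) s).1 +
          c * ((Pi.single r.1.1 w.1 + Pi.single r.1.2 (1 - w.1) : T → F × F) s).2 = 0 := by
    have hne : r.1.1 ≠ r.1.2 := fun h => r.2.ne (congrArg e h)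
    exact ⟨isOrthogonalConicFamily_add w.2.1.1 hne,
      fun h => w.2.1.2 (by simpa [hne] using h r.1.1)⟩
  refine (Nat.card_eq_of_bijective (Sum.elim
    (fun x => ⟨Pi.single x.1 x.2.1, mem₁ x.1 x.2⟩)
    (fun x => ⟨Pi.single x.1.1.1 x.2.1 + Pi.single x.1.1.2 (1 - x.2.1), mem₂ x.1 x.2⟩))
    ⟨?_, ?_⟩).symm
  · have single_ne (i : T) (w : {w : F × F // IsAnisotropicConicPoint c w})
        (r : {r : T × T // e r.1 < e r.2})
        (w' : {w : F × F // IsAnisotropicConicPoint c w ∧ w ≠ 1}) :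
        (Pi.single i w.1 : T → F × F) ≠ Pi.single r.1.1 w'.1 + Pi.single r.1.2 (1 - w'.1) := by
      intro h
      have hne : r.1.1 ≠ r.1.2 := fun h => r.2.ne (congrArg e h)
      have h1 := congrFun h r.1.1
      have h2 := congrFun h r.1.2
      have hw0 := w'.2.1.ne_zero
      have hw1 : 1 - w'.1 ≠ 0 := sub_ne_zero.2 w'.2.2.symm
      simp only [Pi.add_apply, Pi.single_apply, hne, hne.symm, if_true, if_false, add_zero,
        zero_add] at h1 h2
      by_cases hi : r.1.1 = i
      · have hi' : r.1.2 ≠ i := fun h => hne (hi.trans h.symm)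
        rw [if_neg hi'] at h2
        exact hw1 h2.symm
      · rw [if_neg hi] at h1
        exact hw0 h1.symm
    rintro (⟨i, w⟩ | ⟨r, w⟩) (⟨i', w'⟩ | ⟨r', w'⟩) h
    · have h := congrArg Subtype.val h
      simp only [Sum.elim_inl] at h
      have h1 := congrFun h i
      have hi : i = i' := by
        by_contra hne
        rw [Pi.single_eq_same, Pi.single_eq_of_ne hne] at h1
        exact w.2.ne_zero h1
      subst hi
      rw [Pi.single_eq_same, Pi.single_eq_same] at h1
      rw [Subtype.ext h1]
    · exact absurd (congrArg Subtype.val h) (single_ne _ _ _ _)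
    · exact absurd (congrArg Subtype.val h).symm (single_ne _ _ _ _)
    · have h := congrArg Subtype.val h
      obtain ⟨⟨i, j⟩, hij⟩ := r
      obtain ⟨⟨i', j'⟩, hij'⟩ := r'
      simp only [Sum.elim_inr] at h hij hij'
      have hne : i ≠ j := fun h => hij.ne (congrArg e h)
      have hne' : i' ≠ j' := fun h => hij'.ne (congrArg e h)
      have h1 := congrFun h i
      have h2 := congrFun h j
      have hw0 := w.2.1.ne_zero
      have hw1 : 1 - w.1 ≠ 0 := sub_ne_zero.2 w.2.2.symm
      simp only [Pi.add_apply, Pi.single_apply, hne, hne.symm, if_true, if_false, add_zero,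
        zero_add] at h1 h2
      have hi : i = i' ∨ i = j' := by
        by_contra hcon
        push Not at hcon
        rw [if_neg hcon.1, if_neg hcon.2, add_zero] at h1
        exact hw0 h1
      have hj : j = i' ∨ j = j' := by
        by_contra hcon
        push Not at hcon
        rw [if_neg hcon.1, if_neg hcon.2, add_zero] at h2
        exact hw1 h2
      rcases hi with rfl | rfl <;> rcases hj with rfl | rfl
      · exact absurd rfl hne
      · rw [if_pos rfl, if_neg hne, add_zero] at h1
        rw [Subtype.ext h1]
      · exact absurd hij hij'.not_gt
      · exact absurd rfl hne
  · rintro ⟨u, hu, hu'⟩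
    push Not at hu'
    obtain ⟨i, hi⟩ := hu'
    have hia : IsAnisotropicConicPoint c (u i) := ⟨hu.1 i, hi⟩
    rcases hu.eq_single_or_eq_add hc hia with h | ⟨h1, j, hj, h⟩
    · exact ⟨.inl (i, ⟨u i, hia⟩), Subtype.ext h.symm⟩
    · rcases lt_or_gt_of_ne (fun h => hj (e.injective h) : e j ≠ e i) with hlt | hlt
      · have hj1 : (1 : F × F) - u i ≠ 1 := by simpa using hia.ne_zero
        refine ⟨.inr (⟨(j, i), hlt⟩, ⟨1 - u i, hia.one_sub hc h1, hj1⟩), Subtype.ext ?_⟩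
        simp only [Sum.elim_inr, sub_sub_cancel]
        rw [add_comm, ← h]
      · exact ⟨.inr (⟨(i, j), hlt⟩, ⟨u i, hia, h1⟩), Subtype.ext h.symm⟩

lemma card_isConicFamily_neg_one :
    Nat.card {v : (T → F) × (T → F) // IsConicFamily (-1) v} =
      Fintype.card F ^ Fintype.card T + (Fintype.card T + 1).choose 2 *
        Nat.card {w : F × F // IsAnisotropicConicPoint (-1) w ∧ w ≠ 1} := by
  have h1 : Nat.card {w : F × F // IsAnisotropicConicPoint (-1) w} =
      Nat.card {w : F × F // IsAnisotropicConicPoint (-1) w ∧ w ≠ 1} :=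
    Nat.card_congr (Equiv.subtypeEquivRight fun w => (and_iff_left_of_imp (by
      rintro ⟨-, h⟩ rfl
      simp at h)).symm)
  have h2 : Nat.card {u : T → F × F // IsOrthogonalConicFamily (-1) u ∧
      ∀ i, (u i).1 + -1 * (u i).2 = 0} = Fintype.card F ^ Fintype.card T := by
    have : Nat.card (T → F) = Fintype.card F ^ Fintype.card T := by simp
    rw [← this]
    have mem (z : T → F) : IsOrthogonalConicFamily (-1) (fun i => (z i, z i)) ∧
        ∀ i, z i + -1 * z i = 0 :=
      ⟨⟨fun i => by simp [IsConicPoint], fun i j _ => by simp⟩, fun i => by simp⟩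
    refine (Nat.card_eq_of_bijective (fun z : T → F => ⟨fun i => (z i, z i), mem z⟩)
      ⟨fun z z' h => ?_, ?_⟩).symm
    · have h := congrArg Subtype.val h
      exact funext fun i => (Prod.mk.inj (congrFun h i)).1
    · rintro ⟨u, -, hu⟩
      refine ⟨fun i => (u i).1, Subtype.ext (funext fun i => Prod.ext rfl ?_)⟩
      linear_combination hu i
  rw [card_isConicFamily, card_subtype_split _ fun u => ∀ i, (u i).1 + -1 * (u i).2 = 0, h2,
    card_anisotropic_families (by simp), h1, Nat.choose_succ_succ' _ 1, Nat.choose_one_right]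
  ring

lemma card_isConicFamily_of_ne {c : F} (hc : c ≠ 0) (hc' : c ≠ -1) :
    Nat.card {v : (T → F) × (T → F) // IsConicFamily c v} =
      Fintype.card T + 1 + (Fintype.card T + 1).choose 2 *
        Nat.card {w : F × F // IsAnisotropicConicPoint c w ∧ w ≠ 1} := by
  have hc1 : c + 1 ≠ 0 := fun h => hc' (eq_neg_of_add_eq_zero_left h)
  have h1 : Nat.card {w : F × F // IsAnisotropicConicPoint c w} =
      Nat.card {w : F × F // IsAnisotropicConicPoint c w ∧ w ≠ 1} + 1 := by
    rw [card_subtype_split _ fun w => w = 1, add_comm, Nat.add_left_cancel_iff,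
      Nat.card_eq_one_iff_unique]
    refine ⟨⟨fun x y => Subtype.ext (x.2.2.trans y.2.2.symm)⟩, ⟨⟨1, ⟨?_, ?_⟩, rfl⟩⟩⟩
    · simp [IsConicPoint]
    · simpa [add_comm] using hc1
  have h2 : Nat.card {u : T → F × F // IsOrthogonalConicFamily c u ∧
      ∀ i, (u i).1 + c * (u i).2 = 0} = 1 := by
    rw [Nat.card_eq_one_iff_unique]
    have zero (u : {u : T → F × F // IsOrthogonalConicFamily c u ∧
        ∀ i, (u i).1 + c * (u i).2 = 0}) : u.1 = 0 := by
      obtain ⟨u, ⟨hu, -⟩, hu'⟩ := u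
      refine funext fun i => ?_
      have h3 := hu i
      have h4 := hu' i
      have h5 : (u i).2 = 0 := by
        have : (c * (c + 1)) * ((u i).2 * (u i).2) = 0 := by
          simp only [IsConicPoint] at h3
          linear_combination h3 - h4 * ((u i).1 - c * (u i).2 - 1)
        simpa [hc, hc1] using this
      refine Prod.ext ?_ h5
      simpa [h5] using h4
    exact ⟨⟨fun u v => Subtype.ext ((zero u).trans (zero v).symm)⟩,
      ⟨⟨0, ⟨fun _ => isConicPoint_zero, by simp⟩, by simp⟩⟩⟩
  rw [card_isConicFamily, card_subtype_split _ fun u => ∀ i, (u i).1 + c * (u i).2 = 0, h2,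
    card_anisotropic_families hc, h1, Nat.choose_succ_succ' _ 1, Nat.choose_one_right]
  ring

variable [DecidableEq F]

lemma card_anisotropicConicPoint :
    Nat.card {x : Fˣ × (F × F) // IsAnisotropicConicPoint (x.1 : F) x.2 ∧ x.2 ≠ 1} =
      Nat.card (Fˣ ⊕ Fˣ ⊕ ((Finset.univ \ {0, 1} : Finset F).offDiag)) := by
  have unit_ne (x : ((Finset.univ \ {0, 1} : Finset F).offDiag)) :
      -(x.1.1 * (x.1.1 - 1)) / (x.1.2 * (x.1.2 - 1)) ≠ 0 := by
    have h := x.2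
    simp only [Finset.mem_offDiag, Finset.mem_sdiff, Finset.mem_univ, Finset.mem_insert,
      Finset.mem_singleton, true_and, not_or] at h
    simp [sub_eq_zero, h]
  have mem₁ (c : Fˣ) : IsAnisotropicConicPoint (c : F) (1, 0) ∧ ((1, 0) : F × F) ≠ 1 := by
    simp [IsAnisotropicConicPoint, IsConicPoint, Prod.ext_iff]
  have mem₂ (c : Fˣ) : IsAnisotropicConicPoint (c : F) (0, 1) ∧ ((0, 1) : F × F) ≠ 1 := by
    simp [IsAnisotropicConicPoint, IsConicPoint, Prod.ext_iff]
  have mem₃ (x : ((Finset.univ \ {0, 1} : Finset F).offDiag)) :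
      IsAnisotropicConicPoint (Units.mk0 _ (unit_ne x) : F) x.1 ∧ x.1 ≠ 1 := by
    obtain ⟨⟨y, z⟩, h⟩ := x
    simp only [Finset.mem_offDiag, Finset.mem_sdiff, Finset.mem_univ, Finset.mem_insert,
      Finset.mem_singleton, true_and, not_or] at h
    obtain ⟨⟨hy, hy1⟩, ⟨hz, hz1⟩, hyz⟩ := h
    have hz1' : z - 1 ≠ 0 := sub_ne_zero.2 hz1
    simp only [IsAnisotropicConicPoint, IsConicPoint, Units.val_mk0]
    refine ⟨⟨?_, ?_⟩, fun h => hy1 (Prod.mk.inj h).1⟩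
    · field_simp
      ring
    · have : y + -(y * (y - 1)) / (z * (z - 1)) * z = y * (z - y) / (z - 1) := by
        field_simp
        ring
      rw [this]
      exact div_ne_zero (mul_ne_zero hy (sub_ne_zero.2 (Ne.symm hyz))) hz1'
  refine (Nat.card_eq_of_bijective (Sum.elim (fun c => ⟨(c, (1, 0)), mem₁ c⟩) (Sum.elim
    (fun c => ⟨(c, (0, 1)), mem₂ c⟩) (fun x => ⟨(Units.mk0 _ (unit_ne x), x.1), mem₃ x⟩)))
    ⟨?_, ?_⟩).symm
  · rintro (c | c | x) (c' | c' | x') h <;> have h := congrArg Subtype.val h <;>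
      simp only [Sum.elim_inl, Sum.elim_inr, Prod.mk.injEq] at h
    · rw [h.1]
    · simp at h
    · have := x'.2
      simp [← h.2] at this
    · simp at h
    · rw [h.1]
    · have := x'.2
      simp [← h.2] at this
    · have := x.2
      simp [h.2] at this
    · have := x.2
      simp [h.2] at this
    · rw [Subtype.ext h.2]
  · rintro ⟨⟨c, y, z⟩, ⟨hw, hf⟩, h1⟩
    simp only [IsConicPoint] at hw hf
    have hw' : y * (y - 1) + c * (z * (z - 1)) = 0 := by linear_combination hw
    by_cases hz : z = 0 ∨ z = 1
    · have hz' : z * (z - 1) = 0 := by simpa [sub_eq_zero] using hz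
      have hy : y = 0 ∨ y = 1 := by simpa [hz', sub_eq_zero] using hw'
      rcases hz with rfl | rfl <;> rcases hy with rfl | rfl
      · simp at hf
      · exact ⟨.inl c, rfl⟩
      · exact ⟨.inr (.inl c), rfl⟩
      · exact absurd rfl h1
    · have hz' : z * (z - 1) ≠ 0 := by simpa [sub_eq_zero] using hz
      have hy : y * (y - 1) ≠ 0 := by
        intro hy
        simp [hy, mul_ne_zero_iff.1 hz'] at hw'
      have hyz : y ≠ z := by
        rintro rfl
        have h2 : (1 + c : F) = 0 := (mul_eq_zero.1
          (by linear_combination hw' : (1 + c : F) * (y * (y - 1)) = 0)).resolve_right hy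
        exact hf (by linear_combination y * h2)
      have hmem : (y, z) ∈ (Finset.univ \ {0, 1} : Finset F).offDiag := by
        simp only [Finset.mem_offDiag, Finset.mem_sdiff, Finset.mem_univ, Finset.mem_insert,
          Finset.mem_singleton, true_and]
        exact ⟨by simpa [sub_eq_zero] using hy, hz, hyz⟩
      refine ⟨.inr (.inr ⟨(y, z), hmem⟩), Subtype.ext (Prod.ext (Units.ext ?_) rfl)⟩
      simp only [Sum.elim_inr, Units.val_mk0]
      rw [div_eq_iff hz']
      linear_combination -hw'

lemma sum_card_anisotropicConicPoint :
    ((∑ c : Fˣ, Nat.card {w : F × F // IsAnisotropicConicPoint (c : F) w ∧ w ≠ 1} : ℕ) : ℚ) =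
      (Fintype.card F : ℚ) ^ 2 - 3 * Fintype.card F + 4 := by
  have h := card_anisotropicConicPoint (F := F)
  rw [Nat.card_congr (Equiv.subtypeProdEquivSigmaSubtype fun (c : Fˣ) (w : F × F) =>
    IsAnisotropicConicPoint (c : F) w ∧ w ≠ 1), Nat.card_sigma, Nat.card_sum, Nat.card_sum,
    Nat.card_eq_fintype_card, Nat.card_eq_fintype_card, Fintype.card_coe, Fintype.card_units,
    Finset.offDiag_card, Finset.card_sdiff_of_subset (Finset.subset_univ _),
    Finset.card_pair zero_ne_one, Finset.card_univ] at h
  rw [h]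
  obtain ⟨q, hq⟩ := Nat.exists_eq_add_of_le (Fintype.one_lt_card (α := F))
  have hq : Fintype.card F = q + 2 := by omega
  rw [hq, Nat.add_sub_cancel, Nat.add_sub_cancel (n := q + 1) (m := 1)]
  push_cast [Nat.cast_sub (Nat.le_mul_self q)]
  ring

lemma sum_card_isConicFamily :
    ((∑ c : Fˣ, Nat.card {v : (T → F) × (T → F) // IsConicFamily (c : F) v} : ℕ) : ℚ) =
      (Fintype.card F : ℚ) ^ Fintype.card T + (Fintype.card F - 2) * (Fintype.card T + 1) +
        (Fintype.card T + 1).choose 2 * ((Fintype.card F : ℚ) ^ 2 - 3 * Fintype.card F + 4) := by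
  rw [← sum_card_anisotropicConicPoint, ← Finset.add_sum_erase _ _ (Finset.mem_univ (-1 : Fˣ)),
    ← Finset.add_sum_erase (a := (-1 : Fˣ)) _ _ (Finset.mem_univ _),
    Finset.sum_congr rfl fun c hc => card_isConicFamily_of_ne c.ne_zero fun h =>
      Finset.ne_of_mem_erase hc (Units.ext h), Units.val_neg, Units.val_one,
    card_isConicFamily_neg_one, Finset.sum_add_distrib, ← Finset.mul_sum, Finset.sum_const,
    Finset.card_erase_of_mem (Finset.mem_univ _), Finset.card_univ, Fintype.card_units]
  obtain ⟨q, hq⟩ := Nat.exists_eq_add_of_le (Fintype.one_lt_card (α := F))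
  have hq : Fintype.card F = q + 2 := by omega
  rw [hq, Nat.add_sub_cancel (n := q + 1) (m := 1), Nat.add_sub_cancel, smul_eq_mul]
  push_cast
  ring

end Conic

section Total

variable {F S T : Type*} [Field F] [DecidableEq S] [DecidableEq T]

lemma card_isBlockSolution_of_mul_ne_zero {a b d : F} (ha : a ≠ 0) (hb : b ≠ 0) :
    Nat.card {v : (S → F) × (T → F) × (T → F) // IsBlockSolution (a, b, d) v} = 0 := by
  have : IsEmpty {v : (S → F) × (T → F) × (T → F) // IsBlockSolution (a, b, d) v} :=
    ⟨fun v => by simpa [ha, hb] using v.2.1⟩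
  simp

variable [Fintype F] [Fintype S] [Fintype T]

lemma card_isBlockSolution_zero :
    Nat.card {v : (S → F) × (T → F) × (T → F) // IsBlockSolution (0, 0, 0) v} =
      Fintype.card F ^ Fintype.card S * (Fintype.card F ^ Fintype.card T) ^ 2 := by
  rw [Nat.card_congr (Equiv.subtypeUnivEquiv fun v => by simp [IsBlockSolution])]
  simp [sq]

lemma card_isBlockSolution_of_left {b d : F} (h : b ≠ 0 ∨ d ≠ 0) :
    Nat.card {v : (S → F) × (T → F) × (T → F) // IsBlockSolution (0, b, d) v} =
      Fintype.card F ^ Fintype.card S * (Fintype.card F ^ Fintype.card T *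
        (Fintype.card T + 1)) := by
  have : Nat.card {v : (S → F) × (T → F) × (T → F) // IsBlockSolution (0, b, d) v} =
      Nat.card {v : (S → F) × (T → F) × (T → F) // ∀ i j, defect v.2.2 i j = 0} := by
    refine Nat.card_congr (Equiv.subtypeEquivRight fun v => ?_)
    by_cases hb : b = 0
    · simp [IsBlockSolution, hb, h.resolve_left (not_not.2 hb)]
    · simp +contextual [IsBlockSolution, hb]
  rw [this, card_subtype_snd fun v : (T → F) × (T → F) => ∀ i j, defect v.2 i j = 0,
    card_subtype_snd fun v : T → F => ∀ i j, defect v i j = 0, card_orthogonal_idempotents]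
  simp

lemma card_isBlockSolution_of_right {a : F} (ha : a ≠ 0) :
    Nat.card {v : (S → F) × (T → F) × (T → F) // IsBlockSolution (a, 0, 0) v} =
      (Fintype.card S + Fintype.card T + 1) * Fintype.card F ^ Fintype.card T := by
  rw [← card_orthogonal_idempotents_pair]
  exact Nat.card_congr (Equiv.subtypeEquivRight fun v => by simp [IsBlockSolution, ha])

lemma card_isBlockSolution_mul {a c : F} (ha : a ≠ 0) (hc : c ≠ 0) :
    Nat.card {v : (S → F) × (T → F) × (T → F) // IsBlockSolution (a, 0, c * a) v} =
      Fintype.card S * (Fintype.card T + 1) +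
        Nat.card {v : (T → F) × (T → F) // IsConicFamily c v} := by
  rw [← card_conic_blocks hc]
  refine Nat.card_congr (Equiv.subtypeEquivRight fun v => ?_)
  have (i j : T) : c * a * defect v.2.2 i j + a * defect v.2.1 i j = 0 ↔
      defect v.2.1 i j + c * defect v.2.2 i j = 0 := by
    rw [show c * a * defect v.2.2 i j + a * defect v.2.1 i j =
      a * (defect v.2.1 i j + c * defect v.2.2 i j) by ring, mul_eq_zero, or_iff_right ha]
  simp only [IsBlockSolution, IsConicFamily, this]
  simp [ha]

variable [DecidableEq F]

lemma sum_eq_zero_add_sum_units {M : Type*} [AddCommMonoid M] (f : F → M) :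
    ∑ x, f x = f 0 + ∑ u : Fˣ, f u := by
  rw [Fintype.sum_eq_add_sum_subtype_ne f 0]
  congr 1
  exact (Fintype.sum_equiv unitsEquivNeZero _ _ fun _ => rfl).symm

lemma card_isBlockSolution :
    (Nat.card {c : (F × F × F) × ((S → F) × (T → F) × (T → F)) // IsBlockSolution c.1 c.2} : ℚ) =
      (Fintype.card F : ℚ) ^ Fintype.card S * ((Fintype.card F : ℚ) ^ Fintype.card T) ^ 2 +
      ((Fintype.card F : ℚ) ^ 2 - 1) * (Fintype.card T + 1) *
        ((Fintype.card F : ℚ) ^ Fintype.card S * (Fintype.card F : ℚ) ^ Fintype.card T) +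
      (Fintype.card F - 1) * ((Fintype.card S + Fintype.card T + 1) *
        (Fintype.card F : ℚ) ^ Fintype.card T +
        (Fintype.card F - 1) * (Fintype.card S * (Fintype.card T + 1)) +
        (Fintype.card F : ℚ) ^ Fintype.card T +
        (Fintype.card F - 2) * (Fintype.card T + 1) +
        (Fintype.card T + 1).choose 2 *
          ((Fintype.card F : ℚ) ^ 2 - 3 * Fintype.card F + 4)) := by
  have units : (Fintype.card Fˣ : ℚ) = Fintype.card F - 1 := by
    rw [Fintype.card_units, Nat.cast_sub Fintype.card_pos, Nat.cast_one]
  have conic (a : Fˣ) : ∑ d : Fˣ, Nat.card {v : (S → F) × (T → F) × (T → F) //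
      IsBlockSolution ((a : F), 0, (d : F)) v} = Fintype.card Fˣ *
        (Fintype.card S * (Fintype.card T + 1)) +
        ∑ c : Fˣ, Nat.card {v : (T → F) × (T → F) // IsConicFamily (c : F) v} := by
    rw [← Equiv.sum_comp (Equiv.mulRight a)]
    simp only [Equiv.coe_mulRight, Units.val_mul,
      card_isBlockSolution_mul a.ne_zero (Units.ne_zero _), Finset.sum_add_distrib,
      Finset.sum_const, Finset.card_univ, smul_eq_mul]
  have key : Nat.card {c : (F × F × F) × ((S → F) × (T → F) × (T → F)) //
      IsBlockSolution c.1 c.2} = ∑ a : F, ∑ b : F, ∑ d : F,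
        Nat.card {v : (S → F) × (T → F) × (T → F) // IsBlockSolution (a, b, d) v} := by
    rw [Nat.card_congr (Equiv.subtypeProdEquivSigmaSubtype IsBlockSolution), Nat.card_sigma]
    simp only [Fintype.sum_prod_type]
  rw [key]
  have left₁ (b : Fˣ) (d : F) :=
    card_isBlockSolution_of_left (S := S) (T := T) (d := d) (.inl b.ne_zero)
  have left₂ (d : Fˣ) := card_isBlockSolution_of_left (S := S) (T := T) (b := 0) (.inr d.ne_zero)
  have mixed (a b : Fˣ) (d : F) := card_isBlockSolution_of_mul_ne_zero (S := S) (T := T) (d := d)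
    a.ne_zero b.ne_zero
  have right (a : Fˣ) := card_isBlockSolution_of_right (S := S) (T := T) a.ne_zero
  simp only [sum_eq_zero_add_sum_units (F := F), conic, card_isBlockSolution_zero, left₁, left₂,
    mixed, right, Finset.sum_const, Finset.card_univ, smul_eq_mul, mul_zero, add_zero]
  have h := sum_card_isConicFamily (F := F) (T := T)
  push_cast [units] at h ⊢
  rw [h]
  ring

end Total

section Summation

/-- The number of solutions in the blocks of `s` and `t` columns, over a field with `q` elements. -/
def blockCount (q : ℚ) (s t : ℕ) : ℚ :=
  q ^ s * (q ^ t) ^ 2 + (q ^ 2 - 1) * (t + 1) * (q ^ s * q ^ t) +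
    (q - 1) * ((s + t + 1) * q ^ t + (q - 1) * (s * (t + 1)) + q ^ t + (q - 2) * (t + 1) +
      (t + 1) * t / 2 * (q ^ 2 - 3 * q + 4))

lemma sum_blockCount_antidiagonal {q : ℚ} (hq : q - 1 ≠ 0) (r j : ℕ) (hj : j ≤ r + 1) :
    ∑ t ∈ Finset.range j, blockCount q (r - t) t =
      (q ^ r + (q - 1) * (r + 2)) * (q ^ j - 1) / (q - 1) +
      (q ^ 2 - 1) * q ^ r * (j * (j + 1) / 2) +
      (q - 1) ^ 2 * (r * (j * (j + 1) / 2) - (j - 1) * j * (j + 1) / 3) +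
      (q - 1) * (q - 2) * (j * (j + 1) / 2) +
      (q - 1) * (q ^ 2 - 3 * q + 4) * ((j - 1) * j * (j + 1) / 6) := by
  induction j with
  | zero => simp
  | succ j ih =>
    obtain ⟨s, rfl⟩ := Nat.exists_eq_add_of_le (Nat.lt_succ_iff.1 hj)
    rw [Finset.sum_range_succ, ih (by omega), blockCount, Nat.add_sub_cancel_left]
    push_cast
    field_simp
    ring

lemma sum_sum_blockCount {q : ℚ} (hq : q - 1 ≠ 0) (hq' : q + 1 ≠ 0) (M : ℕ) :
    ∑ r ∈ Finset.range M, ∑ t ∈ Finset.range (r + 1), blockCount q (r - t) t =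
      1 / (24 * (q - 1) ^ 2 * (q + 1)) *
        (12 * (M + 1) * M * q ^ (M + 4) + 24 * q ^ (M + 3) - 24 * (M + 2) * M * q ^ (M + 2)
          - 24 * q ^ (M + 1) + 12 * (M + 3) * M * q ^ M + 24 * q ^ (2 * M + 1)
          + (M + 2) * (M + 1) * M * (M - 1) * q ^ 6 - 4 * (M + 2) * (M + 1) * M * (M - 2) * q ^ 5
          + (M + 2) * (M + 1) * M * (7 * M - 23) * q ^ 4
          - 4 * (M + 2) * (M + 1) * ((M + 3) ^ 2 - 11 * (M + 3) + 27) * q ^ 3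
          - M * (5 * (M + 3) ^ 3 - 43 * (M + 3) ^ 2 + 82 * (M + 3) - 56) * q ^ 2
          + 4 * M * (2 * (M + 3) ^ 3 - 19 * (M + 3) ^ 2 + 46 * (M + 3) - 26) * q
          - M * (M - 1) * (M - 2) * (3 * M + 7)) := by
  induction M with
  | zero =>
    rw [Finset.sum_range_zero]
    push_cast
    ring
  | succ M ih =>
    rw [Finset.sum_range_succ, ih, sum_blockCount_antidiagonal hq _ _ le_rfl]
    push_cast
    field_simp
    ring

lemma sum_Icc_eq_sum_range (M : ℕ) (f : ℕ → ℕ → ℚ) :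
    ∑ k ∈ Finset.Icc 1 (M + 1), ∑ l ∈ Finset.Icc (k + 1) (M + 1), f (l - k - 1) (M + 1 - l) =
      ∑ r ∈ Finset.range M, ∑ t ∈ Finset.range (r + 1), f (r - t) t := by
  rw [Finset.sum_sigma', Finset.sum_sigma']
  refine Finset.sum_nbij' (fun x => ⟨M - x.1, M + 1 - x.2⟩) (fun x => ⟨M - x.1, M + 1 - x.2⟩)
    ?_ ?_ ?_ ?_ ?_
  · simp only [Finset.mem_sigma, Finset.mem_Icc, Finset.mem_range]
    omega
  · simp only [Finset.mem_sigma, Finset.mem_Icc, Finset.mem_range]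
    omega
  · rintro ⟨k, l⟩ h
    simp only [Finset.mem_sigma, Finset.mem_Icc] at h
    simp only [Sigma.mk.injEq, heq_eq_eq]
    omega
  · rintro ⟨r, t⟩ h
    simp only [Finset.mem_sigma, Finset.mem_range] at h
    simp only [Sigma.mk.injEq, heq_eq_eq]
    omega
  · rintro ⟨k, l⟩ h
    simp only [Finset.mem_sigma, Finset.mem_Icc] at h
    dsimp only
    congr 1
    omega

lemma gMat_twoAt_eq {m p : ℕ} [Fact p.Prime] {o k l : Fin m} (ho : (o : ℕ) = 0) (hok : o < k)
    (hkl : k < l) :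
    (gMat p (twoAt o k l) : ℚ) = (p : ℚ) ^ (m - 3) * blockCount p (l - k - 1) (m - 1 - l) := by
  have h1 : Fintype.card {i // o < i ∧ i ≠ k ∧ i ≠ l} = m - 3 := by
    have : (Finset.univ.filter fun i => o < i ∧ i ≠ k ∧ i ≠ l) =
        ((Finset.Ioi o).erase l).erase k := by
      ext i
      simp only [Finset.mem_filter_univ, Finset.mem_erase, Finset.mem_Ioi]
      tauto
    rw [Fintype.card_subtype, this, Finset.card_erase_of_mem (by simp [hok, hkl.ne]),
      Finset.card_erase_of_mem (by simp [hok.trans hkl]), Fin.card_Ioi, ho]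
    omega
  have h2 : Fintype.card {i // k < i ∧ i < l} = l - k - 1 := by
    rw [Fintype.card_subtype, Finset.filter_lt_lt_eq_Ioo, Fin.card_Ioo]
  have h3 : Fintype.card {i // l < i} = m - 1 - l := by
    rw [Fintype.card_subtype, Finset.filter_lt_eq_Ioi, Fin.card_Ioi]
  rw [gMat_twoAt hok hkl, card_isThreeRowSolution hok hkl, Nat.card_prod, Nat.cast_mul,
    card_isBlockSolution, Nat.card_eq_fintype_card, Fintype.card_fun, ZMod.card, h1, h2, h3,
    blockCount, Nat.cast_choose_two]
  push_cast
  ring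

end Summation

/-- For a prime `p` and `n ≥ 4`, summing `g_{α_{k,ℓ}}(p)` over the compositions
`α_{k,ℓ}` of length `n-1` with the value `2` in positions `1`, `k+1`, `ℓ+1`
(`1 ≤ k < ℓ ≤ n-2`) and all other parts `1`, the resulting identity of rational
numbers from Corollary `cor222` of the paper holds. -/
theorem gMat_two_two_two_sum (p : ℕ) (hp : p.Prime) (n : ℕ) (hn : 4 ≤ n) :
    (∑ k ∈ Finset.Icc 1 (n - 2), ∑ ℓ ∈ Finset.Icc (k + 1) (n - 2),
        (gMat p (fun i : Fin (n - 1) =>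
          if (i : ℕ) = 0 ∨ (i : ℕ) = k ∨ (i : ℕ) = ℓ then 2 else 1) : ℚ)) =
      (p : ℚ) ^ (n - 4) / (24 * ((p : ℚ) - 1) ^ 2 * ((p : ℚ) + 1)) *
        (12 * ((n : ℚ) - 2) * ((n : ℚ) - 3) * (p : ℚ) ^ (n + 1)
          + 24 * (p : ℚ) ^ n
          - 24 * ((n : ℚ) - 1) * ((n : ℚ) - 3) * (p : ℚ) ^ (n - 1)
          - 24 * (p : ℚ) ^ (n - 2)
          + 12 * (n : ℚ) * ((n : ℚ) - 3) * (p : ℚ) ^ (n - 3)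
          + 24 * (p : ℚ) ^ (2 * n - 5)
          + ((n : ℚ) - 1) * ((n : ℚ) - 2) * ((n : ℚ) - 3) * ((n : ℚ) - 4) * (p : ℚ) ^ 6
          - 4 * ((n : ℚ) - 1) * ((n : ℚ) - 2) * ((n : ℚ) - 3) * ((n : ℚ) - 5) * (p : ℚ) ^ 5
          + ((n : ℚ) - 1) * ((n : ℚ) - 2) * ((n : ℚ) - 3) * (7 * (n : ℚ) - 44) * (p : ℚ) ^ 4
          - 4 * ((n : ℚ) - 1) * ((n : ℚ) - 2) * ((n : ℚ) ^ 2 - 11 * (n : ℚ) + 27) * (p : ℚ) ^ 3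
          - ((n : ℚ) - 3) * (5 * (n : ℚ) ^ 3 - 43 * (n : ℚ) ^ 2 + 82 * (n : ℚ) - 56) * (p : ℚ) ^ 2
          + 4 * ((n : ℚ) - 3) * (2 * (n : ℚ) ^ 3 - 19 * (n : ℚ) ^ 2 + 46 * (n : ℚ) - 26) * (p : ℚ)
          - ((n : ℚ) - 3) * ((n : ℚ) - 4) * ((n : ℚ) - 5) * (3 * (n : ℚ) - 2)) := by
  have := Fact.mk hp
  obtain ⟨N, rfl⟩ := Nat.exists_eq_add_of_le' hn
  have hp1 : (p : ℚ) - 1 ≠ 0 := sub_ne_zero.2 (by exact_mod_cast hp.one_lt.ne')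
  have hp2 : (p : ℚ) + 1 ≠ 0 := by positivity
  have term (k : ℕ) (hk : k ∈ Finset.Icc 1 (N + 2)) (l : ℕ) (hl : l ∈ Finset.Icc (k + 1) (N + 2)) :
      (gMat p (fun i : Fin (N + 3) =>
        if (i : ℕ) = 0 ∨ (i : ℕ) = k ∨ (i : ℕ) = l then 2 else 1) : ℚ) =
      (p : ℚ) ^ N * blockCount p (l - k - 1) (N + 2 - l) := by
    rw [Finset.mem_Icc] at hk hl
    have h := gMat_twoAt_eq (p := p) (o := (⟨0, by omega⟩ : Fin (N + 3))) (k := ⟨k, by omega⟩)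
      (l := ⟨l, by omega⟩) rfl (Fin.mk_lt_mk.2 (by omega)) (Fin.mk_lt_mk.2 (by omega))
    rw [Nat.add_sub_cancel, show N + 3 - 1 = N + 2 from rfl] at h
    rw [← h]
    congr 2
    funext i
    simp only [twoAt, Fin.ext_iff]
  have h := sum_sum_blockCount hp1 hp2 (N + 1)
  rw [← sum_Icc_eq_sum_range] at h
  calc
    _ = (p : ℚ) ^ N * ∑ k ∈ Finset.Icc 1 (N + 2), ∑ l ∈ Finset.Icc (k + 1) (N + 2),
        blockCount p (l - k - 1) (N + 2 - l) := by
      simp only [Finset.mul_sum]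
      exact Finset.sum_congr rfl fun k hk => Finset.sum_congr rfl fun l hl => term k hk l hl
    _ = _ := by
      rw [h, show N + 4 - 4 = N by omega, show N + 4 - 1 = N + 3 by omega,
        show N + 4 - 2 = N + 2 by omega, show N + 4 - 3 = N + 1 by omega,
        show 2 * (N + 4) - 5 = 2 * N + 3 by omega]
      push_cast
      ring
end
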